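/- Let n ≥ 3, let U ⊆ ℝⁿ be open and connected, and let F = α + β be a Randers metric on U whose 1-form β is nowhere zero (for every x ∈ U the covector (b_i(x)) is nonzero). If F is of sectional flag curvature, then F has constant flag curvature: there exists c ∈ ℝ such that K(x, y, v) = c for every x ∈ U and all linearly independent y, v ∈ ℝⁿ. -/

import Mathlib

open scoped BigOperators
open MeasureTheory

noncomputable section

namespace Paper

/-- `E n` is the model space ℝⁿ. -/
abbrev E (n : ℕ) := Fin n → ℝ

/-- `e n i` is the `i`-th standard basis vector of ℝⁿ. -/
def e (n : ℕ) (i : Fin n) : E n := Pi.single i 1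

/-- Partial derivative of `f(x,y)` in the fiber variable `y^i`. -/
def pdy (n : ℕ) (f : E n → E n → ℝ) (i : Fin n) : E n → E n → ℝ :=
  fun x y => fderiv ℝ (f x) y (e n i)

/-- Partial derivative of `f(x,y)` in the base variable `x^k`. -/
def pdx (n : ℕ) (f : E n → E n → ℝ) (k : Fin n) : E n → E n → ℝ :=
  fun x y => fderiv ℝ (fun x' => f x' y) x (e n k)

/-- The square `F²` of the metric. -/
def F2 (n : ℕ) (F : E n → E n → ℝ) : E n → E n → ℝ := fun x y => (F x y) ^ 2

/-- Fundamental tensor `g_{ij} = ½ [F²]_{y^i y^j}`. -/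
def gm (n : ℕ) (F : E n → E n → ℝ) (i j : Fin n) : E n → E n → ℝ :=
  fun x y => (1 / 2 : ℝ) * pdy n (pdy n (F2 n F) j) i x y

/-- The fundamental tensor as a matrix. -/
def gmat (n : ℕ) (F : E n → E n → ℝ) (x y : E n) : Matrix (Fin n) (Fin n) ℝ :=
  Matrix.of fun i j => gm n F i j x y

/-- The inverse fundamental tensor `g^{ij}`. -/
def ginv (n : ℕ) (F : E n → E n → ℝ) (x y : E n) : Matrix (Fin n) (Fin n) ℝ :=
  (gmat n F x y)⁻¹

/-- `F_{y^i}`. -/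
def Fy (n : ℕ) (F : E n → E n → ℝ) (i : Fin n) : E n → E n → ℝ := pdy n F i

/-- Angular metric `h_{ij} = g_{ij} - F_{y^i} F_{y^j}`. -/
def hm (n : ℕ) (F : E n → E n → ℝ) (i j : Fin n) : E n → E n → ℝ :=
  fun x y => gm n F i j x y - Fy n F i x y * Fy n F j x y

/-- Cartan tensor `C_{ijk} = ¼ [F²]_{y^i y^j y^k}`. -/
def Cartan (n : ℕ) (F : E n → E n → ℝ) (i j k : Fin n) : E n → E n → ℝ :=
  fun x y => (1 / 4 : ℝ) * pdy n (pdy n (pdy n (F2 n F) k) j) i x y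

/-- Mean Cartan tensor `I_i = g^{jk} C_{ijk}`. -/
def meanCartan (n : ℕ) (F : E n → E n → ℝ) (i : Fin n) : E n → E n → ℝ :=
  fun x y => ∑ j, ∑ k, ginv n F x y j k * Cartan n F i j k x y

/-- Matsumoto torsion `M_{ijk}`. -/
def Matsumoto (n : ℕ) (F : E n → E n → ℝ) (i j k : Fin n) : E n → E n → ℝ :=
  fun x y => Cartan n F i j k x y -
    (1 / ((n : ℝ) + 1)) * (hm n F i j x y * meanCartan n F k x y +
      hm n F j k x y * meanCartan n F i x y + hm n F k i x y * meanCartan n F j x y)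

/-- Spray coefficients `G^i = ¼ g^{il} ([F²]_{x^k y^l} y^k - [F²]_{x^l})`. -/
def Spray (n : ℕ) (F : E n → E n → ℝ) (i : Fin n) : E n → E n → ℝ :=
  fun x y => (1 / 4 : ℝ) * ∑ l, ginv n F x y i l *
    ((∑ k, pdx n (pdy n (F2 n F) l) k x y * y k) - pdx n (F2 n F) l x y)

/-- Riemann curvature `R^i_k`. -/
def RiemUp (n : ℕ) (F : E n → E n → ℝ) (i k : Fin n) : E n → E n → ℝ :=
  fun x y =>
    2 * pdx n (Spray n F i) k x y
    - (∑ j, y j * pdx n (pdy n (Spray n F i) k) j x y)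
    + 2 * (∑ j, Spray n F j x y * pdy n (pdy n (Spray n F i) k) j x y)
    - ∑ j, pdy n (Spray n F i) j x y * pdy n (Spray n F j) k x y

/-- Riemann curvature with lowered index `R_{jk} = g_{ij} R^i_k`. -/
def Rlow (n : ℕ) (F : E n → E n → ℝ) (j k : Fin n) : E n → E n → ℝ :=
  fun x y => ∑ i, gm n F i j x y * RiemUp n F i k x y

/-- Flag curvature `K(x,y,v)`. -/
def K (n : ℕ) (F : E n → E n → ℝ) (x y v : E n) : ℝ :=
  (∑ j, ∑ k, Rlow n F j k x y * v j * v k) /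
    ((F x y) ^ 2 * ∑ j, ∑ k, hm n F j k x y * v j * v k)

/-- `F` is a Finsler metric on the open set `U ⊆ ℝⁿ`. -/
structure IsFinsler (n : ℕ) (U : Set (E n)) (F : E n → E n → ℝ) : Prop where
  smooth : ContDiffOn ℝ (⊤ : ℕ∞) (fun p : E n × E n => F p.1 p.2) (U ×ˢ {y : E n | y ≠ 0})
  pos : ∀ x ∈ U, ∀ y : E n, y ≠ 0 → 0 < F x y
  homog : ∀ x ∈ U, ∀ y : E n, y ≠ 0 → ∀ c : ℝ, 0 < c → F x (c • y) = c * F x y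
  posdef : ∀ x ∈ U, ∀ y : E n, y ≠ 0 → (gmat n F x y).PosDef

/-- `F` is of sectional flag curvature: `K` only depends on the section. -/
def SectionalFlagCurv (n : ℕ) (U : Set (E n)) (F : E n → E n → ℝ) : Prop :=
  ∀ x ∈ U, ∀ y v y' v' : E n,
    LinearIndependent ℝ ![y, v] → LinearIndependent ℝ ![y', v'] →
    Submodule.span ℝ {y, v} = Submodule.span ℝ {y', v'} →
    K n F x y v = K n F x y' v'

/-- The flag curvature is isotropic at `x`. -/
def IsotropicAt (n : ℕ) (F : E n → E n → ℝ) (x : E n) : Prop :=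
  ∃ c : ℝ, ∀ y v : E n, LinearIndependent ℝ ![y, v] → K n F x y v = c

/-- The spray vector field `G = y^i ∂/∂x^i - 2G^i ∂/∂y^i` acting on a function of `(x,y)`. -/
def Gop (n : ℕ) (F f : E n → E n → ℝ) : E n → E n → ℝ :=
  fun x y => (∑ i, y i * pdx n f i x y) - 2 * ∑ i, Spray n F i x y * pdy n f i x y

/-- Dynamical derivative of a 1-index tensor. -/
def Dyn1 (n : ℕ) (F : E n → E n → ℝ) (T : Fin n → E n → E n → ℝ) (i : Fin n) :
    E n → E n → ℝ :=
  fun x y => Gop n F (T i) x y - ∑ m, pdy n (Spray n F m) i x y * T m x y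

/-- Dynamical derivative of a 2-index tensor. -/
def Dyn2 (n : ℕ) (F : E n → E n → ℝ) (T : Fin n → Fin n → E n → E n → ℝ) (i j : Fin n) :
    E n → E n → ℝ :=
  fun x y => Gop n F (T i j) x y - (∑ m, pdy n (Spray n F m) i x y * T m j x y)
    - ∑ m, pdy n (Spray n F m) j x y * T i m x y

/-- Dynamical derivative of a 3-index tensor. -/
def Dyn3 (n : ℕ) (F : E n → E n → ℝ) (T : Fin n → Fin n → Fin n → E n → E n → ℝ)
    (i j k : Fin n) : E n → E n → ℝ :=
  fun x y => Gop n F (T i j k) x y - (∑ m, pdy n (Spray n F m) i x y * T m j k x y)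
    - (∑ m, pdy n (Spray n F m) j x y * T i m k x y)
    - ∑ m, pdy n (Spray n F m) k x y * T i j m x y

/-- `y` is a polar direction at `x`: `R_{jk} = κ F² h_{jk}` for some constant `κ`. -/
def IsPolarDir (n : ℕ) (F : E n → E n → ℝ) (x y : E n) : Prop :=
  ∃ κ : ℝ, ∀ j k : Fin n, Rlow n F j k x y = κ * (F x y) ^ 2 * hm n F j k x y


section Alg
variable {n : ℕ} {A : Type*} [CommRing A] [Algebra ℝ A]

/-- Abstract coordinate frame on the tangent bundle: commuting derivations. -/
structure Frame (X Y : Fin n → Derivation ℝ A A) (y : Fin n → A) : Prop where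
  XX : ∀ i j f, X i (X j f) = X j (X i f)
  XY : ∀ i j f, Y i (X j f) = X j (Y i f)
  YY : ∀ i j f, Y i (Y j f) = Y j (Y i f)
  Yy : ∀ i j, Y i (y j) = if i = j then 1 else 0
  Xy : ∀ i j, X i (y j) = 0

variable (X Y : Fin n → Derivation ℝ A A) (y : Fin n → A)

/-- Horizontal derivation. -/
def dl (G : Fin n → A) (k : Fin n) : Derivation ℝ A A := X k - ∑ i, Y k (G i) • Y i

/-- The spray as a derivation. -/
def Sp (G : Fin n → A) : Derivation ℝ A A := (∑ k, y k • X k) - (2 : A) • ∑ k, G k • Y k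

/-- Euler derivation. -/
def Eu : Derivation ℝ A A := ∑ k, y k • Y k

/-- Riemann curvature of a spray. -/
def Ru (G : Fin n → A) (i k : Fin n) : A :=
  2 * X k (G i) - (∑ j, y j * X j (Y k (G i))) + 2 * (∑ j, G j * Y j (Y k (G i)))
    - ∑ j, Y j (G i) * Y k (G j)

/-- Curvature of the nonlinear connection. -/
def Rc (G : Fin n → A) (i k l : Fin n) : A :=
  dl X Y G k (Y l (G i)) - dl X Y G l (Y k (G i))

theorem sum_apply' (s : Fin n → A) (D : Fin n → Derivation ℝ A A) (f : A) :
    (∑ i, s i • D i) f = ∑ i, s i * D i f := by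
  induction (Finset.univ : Finset (Fin n)) using Finset.induction_on with
  | empty => simp
  | insert i t hi ih =>
    rw [Finset.sum_insert hi, Finset.sum_insert hi, Derivation.add_apply, ih,
      Derivation.smul_apply, smul_eq_mul]

theorem dl_apply (G : Fin n → A) (k : Fin n) (f : A) :
    dl X Y G k f = X k f - ∑ i, Y k (G i) * Y i f := by
  simp only [dl, Derivation.sub_apply, sum_apply']

theorem Sp_apply (G : Fin n → A) (f : A) :
    Sp X Y y G f = (∑ k, y k * X k f) - 2 * ∑ k, G k * Y k f := by
  simp only [Sp, Derivation.sub_apply, sum_apply', Derivation.smul_apply, smul_eq_mul]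

theorem Eu_apply (f : A) : Eu Y y f = ∑ k, y k * Y k f := by
  simp only [Eu, sum_apply']

theorem D_mul (D : Derivation ℝ A A) (f g : A) : D (f * g) = f * D g + D f * g := by
  rw [Derivation.leibniz, smul_eq_mul, smul_eq_mul]; ring

theorem D_two (D : Derivation ℝ A A) (f : A) : D (2 * f) = 2 * D f := by
  rw [two_mul, map_add, two_mul]

theorem cancel_two {f g : A} (h : 2 * f = 2 * g) : f = g := by
  have h1 : (2:ℝ) • f = (2:ℝ) • g := by
    rw [Algebra.smul_def, Algebra.smul_def, map_ofNat]; exact h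
  exact smul_right_injective A (two_ne_zero) h1

theorem cancel_three {f g : A} (h : 3 * f = 3 * g) : f = g := by
  have h1 : (3:ℝ) • f = (3:ℝ) • g := by
    rw [Algebra.smul_def, Algebra.smul_def, map_ofNat]; exact h
  exact smul_right_injective A (three_ne_zero) h1

variable {X Y y}

theorem Y_dl (hf : Frame X Y y) (G : Fin n → A) (l k : Fin n) (f : A) :
    Y l (dl X Y G k f) = dl X Y G k (Y l f) - ∑ i, Y l (Y k (G i)) * Y i f := by
  rw [dl_apply, dl_apply, map_sub, map_sum, hf.XY]
  simp only [D_mul, Finset.sum_add_distrib]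
  rw [sub_sub]
  congr 2
  exact Finset.sum_congr rfl fun i _ => by rw [hf.YY]

theorem dl_dl (hf : Frame X Y y) (G : Fin n → A) (k l : Fin n) (f : A) :
    dl X Y G k (dl X Y G l f) - dl X Y G l (dl X Y G k f)
      = - ∑ i, Rc X Y G i k l * Y i f := by
  have key : ∀ k l, dl X Y G k (dl X Y G l f) = X k (X l f) - ∑ i, Y k (G i) * X l (Y i f)
      - ∑ i, dl X Y G k (Y l (G i)) * Y i f - ∑ i, Y l (G i) * X k (Y i f)
      + ∑ i, ∑ j, Y l (G i) * Y k (G j) * Y i (Y j f) := by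
    intro k l
    rw [dl_apply X Y G l f, map_sub, map_sum]
    simp only [D_mul, Finset.sum_add_distrib]
    rw [dl_apply X Y G k (X l f)]
    have : ∀ i, Y l (G i) * dl X Y G k (Y i f) = Y l (G i) * X k (Y i f)
        - ∑ j, Y l (G i) * Y k (G j) * Y i (Y j f) := by
      intro i
      rw [dl_apply, mul_sub, Finset.mul_sum]
      congr 1
      exact Finset.sum_congr rfl fun j _ => by rw [hf.YY i j]; ring
    simp only [this, Finset.sum_sub_distrib, hf.XY]
    ring
  rw [key k l, key l k, hf.XX l k, Finset.sum_comm (f := fun i j => Y k (G i) * Y l (G j) * Y i (Y j f))]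
  have e1 : ∑ i, ∑ j, Y k (G j) * Y l (G i) * Y j (Y i f)
      = ∑ i, ∑ j, Y l (G i) * Y k (G j) * Y i (Y j f) :=
    Finset.sum_congr rfl fun i _ => Finset.sum_congr rfl fun j _ => by rw [hf.YY i j]; ring
  rw [e1]
  simp only [Rc, sub_mul, Finset.sum_sub_distrib]
  ring

theorem dl_y (hf : Frame X Y y) (G : Fin n → A) (k l : Fin n) :
    dl X Y G k (y l) = - Y k (G l) := by
  rw [dl_apply, hf.Xy]
  simp [hf.Yy]

theorem sum_y_dl (G : Fin n → A) (hG : ∀ i, Eu Y y (G i) = 2 * G i) (f : A) :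
    ∑ l, y l * dl X Y G l f = Sp X Y y G f := by
  simp only [dl_apply, mul_sub, Finset.sum_sub_distrib, Finset.mul_sum, Sp_apply]
  rw [Finset.sum_comm]
  congr 1
  refine Finset.sum_congr rfl fun i _ => ?_
  have := hG i
  rw [Eu_apply] at this
  rw [← mul_assoc 2, ← this, Finset.sum_mul]
  exact Finset.sum_congr rfl fun j _ => by ring

theorem Ru_eq (hf : Frame X Y y) (G : Fin n → A) (hG : ∀ i, Eu Y y (G i) = 2 * G i) (i k : Fin n) :
    Ru X Y y G i k = ∑ l, y l * Rc X Y G i k l := by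
  simp only [Rc, mul_sub, Finset.sum_sub_distrib]
  rw [sum_y_dl G hG, Sp_apply]
  have h1 : dl X Y G k (Eu Y y (G i)) = 2 * dl X Y G k (G i) := by rw [hG, D_two]
  rw [Eu_apply, map_sum] at h1
  simp only [D_mul, Finset.sum_add_distrib, dl_y hf] at h1
  rw [eq_sub_of_add_eq h1, dl_apply, Ru]
  have : ∑ x, -Y k (G x) * Y x (G i) = - ∑ x, Y k (G x) * Y x (G i) := by
    simp [Finset.sum_neg_distrib]
  have e : ∑ j, Y j (G i) * Y k (G j) = ∑ x, Y k (G x) * Y x (G i) :=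
    Finset.sum_congr rfl fun _ _ => mul_comm _ _
  rw [this, e]
  ring

theorem Rc_anti (G : Fin n → A) (i k l : Fin n) : Rc X Y G i k l = - Rc X Y G i l k := by
  simp [Rc]

theorem Y_Rc (hf : Frame X Y y) (G : Fin n → A) (m i k l : Fin n) :
    Y m (Rc X Y G i k l) = (dl X Y G k (Y m (Y l (G i))) - ∑ p, Y m (Y k (G p)) * Y p (Y l (G i)))
      - (dl X Y G l (Y m (Y k (G i))) - ∑ p, Y m (Y l (G p)) * Y p (Y k (G i))) := by
  rw [Rc, map_sub, Y_dl hf, Y_dl hf]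

theorem Y_Rc_cyc (hf : Frame X Y y) (G : Fin n → A) (m i k l : Fin n) :
    Y m (Rc X Y G i k l) + Y k (Rc X Y G i l m) + Y l (Rc X Y G i m k) = 0 := by
  rw [Y_Rc hf, Y_Rc hf, Y_Rc hf]
  simp only [hf.YY m l, hf.YY k m, hf.YY l k]
  ring

theorem Eu_X (hf : Frame X Y y) (k : Fin n) (f : A) : Eu Y y (X k f) = X k (Eu Y y f) := by
  simp only [Eu_apply, map_sum, D_mul, hf.Xy, hf.XY, zero_mul, add_zero]

theorem Eu_Y (hf : Frame X Y y) (k : Fin n) (f : A) :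
    Eu Y y (Y k f) = Y k (Eu Y y f) - Y k f := by
  simp only [Eu_apply, map_sum, D_mul, hf.Yy, Finset.sum_add_distrib]
  simp [hf.YY k]

theorem Eu_dl (hf : Frame X Y y) (G : Fin n → A) (hG : ∀ i, Eu Y y (G i) = 2 * G i)
    (k : Fin n) (f : A) : Eu Y y (dl X Y G k f) = dl X Y G k (Eu Y y f) := by
  rw [dl_apply, dl_apply, map_sub, map_sum, Eu_X hf]
  congr 1
  refine Finset.sum_congr rfl fun i _ => ?_
  rw [D_mul, Eu_Y hf, Eu_Y hf, hG, D_two]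
  ring

theorem Eu_Rc (hf : Frame X Y y) (G : Fin n → A) (hG : ∀ i, Eu Y y (G i) = 2 * G i)
    (i k l : Fin n) : Eu Y y (Rc X Y G i k l) = Rc X Y G i k l := by
  have : ∀ l, Eu Y y (Y l (G i)) = Y l (G i) := by
    intro l; rw [Eu_Y hf, hG, D_two]; ring
  rw [Rc, map_sub, Eu_dl hf G hG, Eu_dl hf G hG, this, this]

theorem Rc_of_Ru (hf : Frame X Y y) (G : Fin n → A) (hG : ∀ i, Eu Y y (G i) = 2 * G i)
    (i k m : Fin n) :
    Y m (Ru X Y y G i k) - Y k (Ru X Y y G i m) = 3 * Rc X Y G i k m := by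
  have h : ∀ m k, Y m (Ru X Y y G i k) = Rc X Y G i k m + ∑ l, y l * Y m (Rc X Y G i k l) := by
    intro m k
    rw [Ru_eq hf G hG, map_sum]
    simp only [D_mul, hf.Yy, Finset.sum_add_distrib]
    simp [add_comm]
  rw [h, h]
  have h2 : ∑ l, y l * Y m (Rc X Y G i k l) - ∑ l, y l * Y k (Rc X Y G i m l)
      = Eu Y y (Rc X Y G i k m) := by
    rw [Eu_apply, ← Finset.sum_sub_distrib]
    refine Finset.sum_congr rfl fun l _ => ?_
    have := Y_Rc_cyc hf G m i k l
    have e1 : Y k (Rc X Y G i m l) = - Y k (Rc X Y G i l m) := by rw [Rc_anti, map_neg]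
    have e2 : Y l (Rc X Y G i k m) = - Y l (Rc X Y G i m k) := by rw [Rc_anti, map_neg]
    rw [e1, e2]
    linear_combination (y l) * this
  rw [Eu_Rc hf G hG] at h2
  have e3 := Rc_anti (X := X) (Y := Y) G i m k
  linear_combination h2 - e3

theorem Bianchi2 (hf : Frame X Y y) (G : Fin n → A) (i k l m : Fin n) :
    (dl X Y G m (Rc X Y G i k l) + ∑ j, Rc X Y G j k l * Y j (Y m (G i)))
    + (dl X Y G k (Rc X Y G i l m) + ∑ j, Rc X Y G j l m * Y j (Y k (G i)))
    + (dl X Y G l (Rc X Y G i m k) + ∑ j, Rc X Y G j m k * Y j (Y l (G i))) = 0 := by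
  have h1 := dl_dl hf G m k (Y l (G i))
  have h2 := dl_dl hf G k l (Y m (G i))
  have h3 := dl_dl hf G l m (Y k (G i))
  simp only [show ∀ k l, Rc X Y G i k l = dl X Y G k (Y l (G i)) - dl X Y G l (Y k (G i)) from
    fun _ _ => rfl, map_sub]
  linear_combination h1 + h2 + h3

/-! Metric sprays -/

theorem SpL (hf : Frame X Y y) (G : Fin n → A) (L : A) (hL : Eu Y y L = 2 * L)
    (hEL : ∀ l, Sp X Y y G (Y l L) = X l L) : Sp X Y y G L = 0 := by
  have hSy : ∀ l, Sp X Y y G (y l) = - 2 * G l := by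
    intro l
    rw [Sp_apply]; simp [hf.Xy, hf.Yy]
  have h1 : Sp X Y y G (Eu Y y L) = 2 * Sp X Y y G L := by rw [hL, D_two]
  rw [Eu_apply, map_sum] at h1
  simp only [D_mul, hEL, hSy, Finset.sum_add_distrib] at h1
  have h2 : ∑ x, -2 * G x * Y x L = - (2 * ∑ x, G x * Y x L) := by
    rw [Finset.mul_sum, ← Finset.sum_neg_distrib]
    exact Finset.sum_congr rfl fun _ _ => by ring
  rw [h2, ← sub_eq_add_neg, ← Sp_apply X Y y G L] at h1
  linear_combination -h1

theorem dlL (hf : Frame X Y y) (G : Fin n → A) (L : A) (hL : Eu Y y L = 2 * L)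
    (hEL : ∀ l, Sp X Y y G (Y l L) = X l L) (l : Fin n) : dl X Y G l L = 0 := by
  have h0 := SpL hf G L hL hEL
  have h1 : Y l (Sp X Y y G L) = 0 := by rw [h0, map_zero]
  have h2 : Y l (Sp X Y y G L) = Sp X Y y G (Y l L) + X l L - 2 * ∑ i, Y l (G i) * Y i L := by
    rw [Sp_apply, Sp_apply, map_sub, map_sum, D_two, map_sum]
    simp only [D_mul, hf.Yy, Finset.sum_add_distrib, hf.XY]
    simp only [ite_mul, one_mul, zero_mul, Finset.sum_ite_eq, Finset.mem_univ, if_true, hf.YY l]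
    ring
  rw [h2, hEL] at h1
  rw [dl_apply]
  apply cancel_two
  linear_combination h1

theorem uRc (hf : Frame X Y y) (G : Fin n → A) (L : A) (hL : Eu Y y L = 2 * L)
    (hEL : ∀ l, Sp X Y y G (Y l L) = X l L) (k l : Fin n) :
    ∑ i, Rc X Y G i k l * Y i L = 0 := by
  have := dl_dl hf G k l L
  rw [dlL hf G L hL hEL, dlL hf G L hL hEL, map_zero, map_zero, sub_zero] at this
  exact neg_eq_zero.mp this.symm

theorem uRu (hf : Frame X Y y) (G : Fin n → A) (hG : ∀ i, Eu Y y (G i) = 2 * G i)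
    (L : A) (hL : Eu Y y L = 2 * L)
    (hEL : ∀ l, Sp X Y y G (Y l L) = X l L) (k : Fin n) :
    ∑ i, Ru X Y y G i k * Y i L = 0 := by
  simp only [Ru_eq hf G hG, Finset.sum_mul]
  rw [Finset.sum_comm]
  refine Finset.sum_eq_zero fun l _ => ?_
  have := uRc hf G L hL hEL k l
  calc _ = y l * ∑ i, Rc X Y G i k l * Y i L := by
        rw [Finset.mul_sum]; exact Finset.sum_congr rfl fun _ _ => by ring
    _ = 0 := by rw [this, mul_zero]

theorem Ru_y (hf : Frame X Y y) (G : Fin n → A) (hG : ∀ i, Eu Y y (G i) = 2 * G i) (i : Fin n) :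
    ∑ k, Ru X Y y G i k * y k = 0 := by
  simp only [Ru_eq hf G hG, Finset.sum_mul]
  have h : ∑ k, ∑ l, y l * Rc X Y G i k l * y k = - ∑ k, ∑ l, y l * Rc X Y G i k l * y k := by
    conv_lhs => rw [Finset.sum_comm]
    rw [← Finset.sum_neg_distrib]
    refine Finset.sum_congr rfl fun k _ => ?_
    rw [← Finset.sum_neg_distrib]
    refine Finset.sum_congr rfl fun l _ => ?_
    rw [Rc_anti]; ring
  apply cancel_two
  linear_combination h

theorem Y_uRc (hf : Frame X Y y) (G : Fin n → A) (L : A) (hL : Eu Y y L = 2 * L)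
    (hEL : ∀ l, Sp X Y y G (Y l L) = X l L) (k l m : Fin n) :
    ∑ i, Rc X Y G i k l * Y m (Y i L) = - ∑ i, Y m (Rc X Y G i k l) * Y i L := by
  have h : Y m (∑ i, Rc X Y G i k l * Y i L) = 0 := by rw [uRc hf G L hL hEL, map_zero]
  rw [map_sum] at h
  simp only [D_mul, Finset.sum_add_distrib] at h
  exact eq_neg_of_add_eq_zero_left h

theorem Ru_symm (hf : Frame X Y y) (G : Fin n → A) (hG : ∀ i, Eu Y y (G i) = 2 * G i)
    (L : A) (hL : Eu Y y L = 2 * L)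
    (hEL : ∀ l, Sp X Y y G (Y l L) = X l L) (k m : Fin n) :
    ∑ i, Ru X Y y G i k * Y m (Y i L) = ∑ i, Ru X Y y G i m * Y k (Y i L) := by
  have hc : ∀ l, ∑ i, Rc X Y G i k l * Y m (Y i L) + ∑ i, Rc X Y G i l m * Y k (Y i L)
      + ∑ i, Rc X Y G i m k * Y l (Y i L) = 0 := by
    intro l
    rw [Y_uRc hf G L hL hEL, Y_uRc hf G L hL hEL, Y_uRc hf G L hL hEL, ← neg_add, ← neg_add,
      ← Finset.sum_add_distrib, ← Finset.sum_add_distrib, neg_eq_zero]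
    refine Finset.sum_eq_zero fun i _ => ?_
    rw [← add_mul, ← add_mul, Y_Rc_cyc hf, zero_mul]
  have hEY : ∀ i, ∑ l, y l * Y l (Y i L) = Y i L := by
    intro i
    rw [← Eu_apply, Eu_Y hf, hL, D_two]; ring
  have h3 : ∑ l, y l * ∑ i, Rc X Y G i m k * Y l (Y i L) = 0 := by
    rw [← uRc hf G L hL hEL m k]
    simp only [Finset.mul_sum]
    rw [Finset.sum_comm]
    refine Finset.sum_congr rfl fun i _ => ?_
    rw [← hEY i, Finset.mul_sum]
    exact Finset.sum_congr rfl fun _ _ => by rw [hEY i]; ring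
  have h1 : ∀ k m, ∑ l, y l * ∑ i, Rc X Y G i k l * Y m (Y i L) = ∑ i, Ru X Y y G i k * Y m (Y i L) := by
    intro k m
    simp only [Finset.mul_sum, Ru_eq hf G hG, Finset.sum_mul]
    rw [Finset.sum_comm]
    exact Finset.sum_congr rfl fun _ _ => Finset.sum_congr rfl fun _ _ => by ring
  have h2 : ∑ l, y l * ∑ i, Rc X Y G i l m * Y k (Y i L) = - ∑ i, Ru X Y y G i m * Y k (Y i L) := by
    rw [← h1, ← Finset.sum_neg_distrib]
    refine Finset.sum_congr rfl fun l _ => ?_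
    rw [← mul_neg, ← Finset.sum_neg_distrib]
    congr 1
    exact Finset.sum_congr rfl fun i _ => by rw [Rc_anti]; ring
  have : ∑ l, y l * (∑ i, Rc X Y G i k l * Y m (Y i L) + ∑ i, Rc X Y G i l m * Y k (Y i L)
      + ∑ i, Rc X Y G i m k * Y l (Y i L)) = 0 :=
    Finset.sum_eq_zero fun l _ => by rw [hc, mul_zero]
  simp only [mul_add, Finset.sum_add_distrib] at this
  rw [h1, h2, h3] at this
  linear_combination this

/-- Algebraic Schur lemma. -/
theorem schur (hf : Frame X Y y) (G : Fin n → A) (hG : ∀ i, Eu Y y (G i) = 2 * G i)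
    (L c : A) (hL : Eu Y y L = 2 * L)
    (hEL : ∀ l, Sp X Y y G (Y l L) = X l L) (hc : ∀ k, Y k c = 0)
    (hR : ∀ i k, 2 * Ru X Y y G i k = c * ((if i = k then 2 * L else 0) - Y k L * y i))
    (k l m : Fin n) (hkl : k ≠ l) (hkm : k ≠ m) (hlm : l ≠ m) :
    X m c * Y l L = X l c * Y m L := by
  have hRc : ∀ i k m, 2 * Rc X Y G i k m =
      c * ((if i = k then Y m L else 0) - (if i = m then Y k L else 0)) := by
    intro i k m
    apply cancel_three
    have h := Rc_of_Ru hf G hG i k m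
    have e : ∀ k m, 2 * Y m (Ru X Y y G i k) = c * ((if i = k then 2 * Y m L else 0)
        - (Y m (Y k L) * y i + Y k L * (if i = m then 1 else 0))) := by
      intro k m
      rw [← D_two, hR, D_mul, hc, map_sub, D_mul, hf.Yy]
      have : Y m (if i = k then 2 * L else 0) = if i = k then 2 * Y m L else 0 := by
        split_ifs
        · rw [D_two]
        · rw [map_zero]
      rw [this]
      simp only [eq_comm (a := m) (b := i)]
      ring
    have e1 := e k m
    have e2 := e m k
    rw [hf.YY k m] at e2
    split_ifs at * <;> linear_combination (-2 : A) * h + e1 - e2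
  have hdc : ∀ k, dl X Y G k c = X k c := by
    intro k; rw [dl_apply]; simp [hc]
  have hdu : ∀ k l, dl X Y G k (Y l L) = ∑ i, Y l (Y k (G i)) * Y i L := by
    intro k l
    have := Y_dl hf G l k L
    rw [dlL hf G L hL hEL, map_zero] at this
    exact (sub_eq_zero.mp this.symm)
  have hB := Bianchi2 hf G k k l m
  have hsum : ∀ k' l' m', 2 * ∑ j, Rc X Y G j k' l' * Y j (Y m' (G k))
      = c * (Y l' L * Y k' (Y m' (G k)) - Y k' L * Y l' (Y m' (G k))) := by
    intro k' l' m'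
    rw [Finset.mul_sum]
    have : ∀ j, 2 * (Rc X Y G j k' l' * Y j (Y m' (G k))) =
       (if j = k' then c * Y l' L * Y j (Y m' (G k)) else 0)
        - (if j = l' then c * Y k' L * Y j (Y m' (G k)) else 0) := by
      intro j
      rw [← mul_assoc, hRc]
      split_ifs <;> ring
    simp only [this, Finset.sum_sub_distrib, Finset.sum_ite_eq', Finset.mem_univ, if_true]
    ring
  have hd : ∀ k' l' m', 2 * dl X Y G m' (Rc X Y G k k' l') =
      X m' c * ((if k = k' then Y l' L else 0) - (if k = l' then Y k' L else 0))
      + c * ((if k = k' then ∑ i, Y l' (Y m' (G i)) * Y i L else 0)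
        - (if k = l' then ∑ i, Y k' (Y m' (G i)) * Y i L else 0)) := by
    intro k' l' m'
    rw [← D_two, hRc, D_mul, hdc, map_sub]
    split_ifs <;> simp [hdu] <;> ring
  have h2 := congrArg (fun t => 2 * t) hB
  simp only [mul_add, hsum, hd, mul_zero, if_neg hkl, if_neg hkm, if_true] at h2
  simp only [hf.YY m l, hf.YY k m, hf.YY l k] at h2
  linear_combination h2

end Alg

section Alg2
variable {n : ℕ} {A : Type*} [CommRing A] [Algebra ℝ A]
variable {X Y : Fin n → Derivation ℝ A A} {y : Fin n → A}

theorem Ru_proj (hf : Frame X Y y) (G : Fin n → A) (hG : ∀ i, Eu Y y (G i) = 2 * G i)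
    (P : A) (hP : Eu Y y P = P) :
    ∃ (Ξ : A) (τ : Fin n → A), ∀ i k, Ru X Y y (fun i => G i + P * y i) i k
      = Ru X Y y G i k + (if i = k then Ξ else 0) + τ k * y i := by
  refine ⟨P * P - (∑ j, y j * X j P) + 2 * ∑ j, G j * Y j P,
    fun k => 2 * X k P - (∑ j, y j * X j (Y k P)) + 2 * (∑ j, G j * Y j (Y k P))
      - (∑ j, Y j P * Y k (G j)) - P * Y k P, fun i k => ?_⟩
  have hN : ∀ i k, Y k (G i + P * y i) = Y k (G i) + P * (if k = i then 1 else 0) + Y k P * y i := by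
    intro i k
    rw [map_add, D_mul, hf.Yy]; ring
  have hδ : ∀ (D : Derivation ℝ A A) (i k : Fin n), D (if k = i then (1:A) else 0) = 0 := by
    intro D i k; split_ifs <;> simp
  have h1 : ∑ j, y j * X j (Y k (G i + P * y i)) = ∑ j, y j * X j (Y k (G i))
      + (∑ j, y j * X j P) * (if k = i then 1 else 0) + (∑ j, y j * X j (Y k P)) * y i := by
    rw [Finset.sum_mul, Finset.sum_mul, ← Finset.sum_add_distrib, ← Finset.sum_add_distrib]
    refine Finset.sum_congr rfl fun j _ => ?_
    rw [hN, map_add, map_add, D_mul, D_mul, hδ, hf.Xy]; ring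
  have hYN : ∀ j, Y j (Y k (G i + P * y i)) = Y j (Y k (G i)) + Y j P * (if k = i then 1 else 0)
      + Y j (Y k P) * y i + Y k P * (if j = i then 1 else 0) := by
    intro j
    rw [hN, map_add, map_add, D_mul, D_mul, hδ, hf.Yy]; ring
  have hE1 : ∑ j, y j * Y j (Y k (G i)) = Y k (G i) := by
    rw [← Eu_apply, Eu_Y hf, hG, D_two]; ring
  have hE2 : ∑ j, y j * Y j (Y k P) = 0 := by
    rw [← Eu_apply, Eu_Y hf, hP]; ring
  have hE3 : ∑ j, y j * Y j P = P := by rw [← Eu_apply, hP]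
  have hE4 : ∑ j, y j * Y j (G i) = 2 * G i := by rw [← Eu_apply, hG]
  have h2 : ∑ j, (G j + P * y j) * Y j (Y k (G i + P * y i)) =
      (∑ j, G j * Y j (Y k (G i))) + (∑ j, G j * Y j P) * (if k = i then 1 else 0)
      + (∑ j, G j * Y j (Y k P)) * y i + Y k P * G i
      + P * (∑ j, y j * Y j (Y k (G i))) + P * (∑ j, y j * Y j P) * (if k = i then 1 else 0)
      + P * (∑ j, y j * Y j (Y k P)) * y i + P * Y k P * y i := by
    have e1 : Y k P * G i = ∑ j, G j * Y k P * (if j = i then 1 else 0) := by simp [mul_comm]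
    have e2 : P * Y k P * y i = ∑ j, P * Y k P * y j * (if j = i then 1 else 0) := by simp
    rw [e1, e2]
    simp only [Finset.mul_sum, Finset.sum_mul, ← Finset.sum_add_distrib]
    refine Finset.sum_congr rfl fun j _ => ?_
    rw [hYN]; ring
  have h3 : ∑ j, Y j (G i + P * y i) * Y k (G j + P * y j) =
      (∑ j, Y j (G i) * Y k (G j)) + P * Y k (G i) + Y k P * (∑ j, y j * Y j (G i))
      + P * Y k (G i) + P * P * (if k = i then 1 else 0) + P * Y k P * y i
      + (∑ j, Y j P * Y k (G j)) * y i + P * Y k P * y i + Y k P * (∑ j, y j * Y j P) * y i := by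
    have e1 : P * Y k (G i) = ∑ j, P * Y j (G i) * (if k = j then 1 else 0) := by simp
    have e1' : P * Y k (G i) = ∑ j, P * Y k (G j) * (if j = i then 1 else 0) := by simp
    have e2 : P * P * (if k = i then 1 else 0) =
      ∑ j, P * P * (if k = j then 1 else 0) * (if j = i then 1 else 0) := by simp
    have e3 : P * Y k P * y i = ∑ j, P * Y k P * y j * (if j = i then 1 else 0) := by simp
    have e4 : P * Y k P * y i = ∑ j, P * Y j P * y i * (if k = j then 1 else 0) := by simp
    calc _ = (∑ j, Y j (G i) * Y k (G j)) + (∑ j, P * Y j (G i) * (if k = j then 1 else 0))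
      + Y k P * (∑ j, y j * Y j (G i))
      + (∑ j, P * Y k (G j) * (if j = i then 1 else 0))
      + (∑ j, P * P * (if k = j then 1 else 0) * (if j = i then 1 else 0))
      + (∑ j, P * Y k P * y j * (if j = i then 1 else 0))
      + (∑ j, Y j P * Y k (G j)) * y i + (∑ j, P * Y j P * y i * (if k = j then 1 else 0))
      + Y k P * (∑ j, y j * Y j P) * y i := by
          simp only [Finset.mul_sum, Finset.sum_mul, ← Finset.sum_add_distrib]
          refine Finset.sum_congr rfl fun j _ => ?_
          rw [hN, hN]; ring
      _ = _ := by rw [← e1, ← e1', ← e2, ← e3, ← e4]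
  have h0 : X k (G i + P * y i) = X k (G i) + X k P * y i := by
    rw [map_add, D_mul, hf.Xy]; ring
  rw [hE1, hE2, hE3] at h2
  rw [hE3, hE4] at h3
  simp only [Ru]
  rw [h0, h1, h2, h3]
  simp only [eq_comm (a := k) (b := i)]
  split_ifs <;> ring

/-- Abstract Randers data. -/
structure RData (X Y : Fin n → Derivation ℝ A A) (y : Fin n → A) (a ai : Fin n → Fin n → A)
    (b : Fin n → A) (al ali Fi : A) : Prop where
  fr : Frame X Y y
  asymm : ∀ i j, a i j = a j i
  Ya : ∀ k i j, Y k (a i j) = 0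
  Yai : ∀ k i j, Y k (ai i j) = 0
  Yb : ∀ k i, Y k (b i) = 0
  aai : ∀ i j, ∑ l, a i l * ai l j = if i = j then 1 else 0
  alsq : al * al = ∑ i, ∑ j, a i j * y i * y j
  hali : al * ali = 1
  hFi : (al + ∑ i, b i * y i) * Fi = 1

/-- One half. -/
def hf2 (A : Type*) [CommRing A] [Algebra ℝ A] : A := algebraMap ℝ A (1 / 2)

theorem two_hf : 2 * hf2 A = 1 := by
  rw [hf2, ← map_ofNat (algebraMap ℝ A) 2, ← map_mul]; norm_num

theorem D_hf (D : Derivation ℝ A A) (f : A) : D (hf2 A * f) = hf2 A * D f := by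
  rw [D_mul, hf2, Derivation.map_algebraMap]; ring

section
variable (X Y y)
variable (a ai : Fin n → Fin n → A) (b : Fin n → A) (al Fi : A)

/-- lowered position. -/
def yl (l : Fin n) : A := ∑ k, a l k * y k
/-- exterior derivative of the one-form. -/
def cc (k l : Fin n) : A := X k (b l) - X l (b k)
/-- raised. -/
def ss (i k : Fin n) : A := ∑ l, ai i l * cc X b k l
/-- contracted. -/
def sv (i : Fin n) : A := ∑ k, ss X ai b i k * y k
/-- Riemannian spray right side. -/
def rho (l : Fin n) : A := (∑ k, y k * X k (Y l (al * al))) - X l (al * al)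
/-- Riemannian spray. -/
def Ga (k : Fin n) : A := hf2 A * (hf2 A * ∑ l, ai k l * rho X Y y al l)
/-- the odd part. -/
def Bq (i : Fin n) : A := hf2 A * (al * sv X y ai b i)
/-- sum. -/
def G0 (i : Fin n) : A := Ga X Y y ai al i + Bq X y ai b al i
/-- projective factor. -/
def Pf : A := hf2 A * (Sp X Y y (G0 X Y y ai b al) (al + ∑ i, b i * y i) * Fi)
/-- Randers spray. -/
def GR (i : Fin n) : A := G0 X Y y ai b al i + Pf X Y y ai b al Fi * y i
end

variable {a ai : Fin n → Fin n → A} {b : Fin n → A} {al ali Fi : A}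

theorem Y_base_y (hf : Frame X Y y) (f : Fin n → A) (hfY : ∀ k i, Y k (f i) = 0) (l : Fin n) :
    Y l (∑ k, f k * y k) = f l := by
  rw [map_sum]
  simp [hfY, hf.Yy]

namespace RData

theorem Yyl (h : RData X Y y a ai b al ali Fi) (k l : Fin n) : Y k (yl y a l) = a l k :=
  Y_base_y h.fr (a l) (fun k i => h.Ya k l i) k

theorem Ysq (h : RData X Y y a ai b al ali Fi) (l : Fin n) : Y l (al * al) = 2 * yl y a l := by
  rw [h.alsq, map_sum]
  have : ∀ i, Y l (∑ j, a i j * y i * y j) = (if l = i then yl y a i else 0) + y i * a i l := by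
    intro i
    have e : ∑ j, a i j * y i * y j = y i * yl y a i := by
      rw [yl, Finset.mul_sum]; exact Finset.sum_congr rfl fun _ _ => by ring
    rw [e, D_mul, h.Yyl, h.fr.Yy]
    split_ifs <;> ring
  simp only [this, Finset.sum_add_distrib, Finset.sum_ite_eq, Finset.mem_univ, if_true]
  rw [two_mul]
  congr 1
  exact Finset.sum_congr rfl fun i _ => by rw [h.asymm l i]; ring

theorem YYsq (h : RData X Y y a ai b al ali Fi) (k l : Fin n) : Y k (Y l (al * al)) = 2 * a l k := by
  rw [h.Ysq, D_two, h.Yyl]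

theorem sum_yl (h : RData X Y y a ai b al ali Fi) : ∑ l, y l * yl y a l = al * al := by
  rw [h.alsq]
  refine Finset.sum_congr rfl fun i _ => ?_
  rw [yl, Finset.mul_sum]; exact Finset.sum_congr rfl fun _ _ => by ring

theorem Eusq (h : RData X Y y a ai b al ali Fi) : Eu Y y (al * al) = 2 * (al * al) := by
  rw [Eu_apply]
  simp only [h.Ysq]
  rw [← h.sum_yl, Finset.mul_sum]
  exact Finset.sum_congr rfl fun _ _ => by ring

theorem alY (h : RData X Y y a ai b al ali Fi) (l : Fin n) : al * Y l al = yl y a l := by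
  apply cancel_two
  rw [← h.Ysq, D_mul]; ring

theorem Yal (h : RData X Y y a ai b al ali Fi) (l : Fin n) : Y l al = ali * yl y a l := by
  linear_combination ali * h.alY l - Y l al * h.hali

theorem Eual (h : RData X Y y a ai b al ali Fi) : Eu Y y al = al := by
  have e : al * Eu Y y al = al * al := by
    apply cancel_two
    rw [← h.Eusq, D_mul]; ring
  linear_combination ali * e - (Eu Y y al - al) * h.hali

theorem alYY (h : RData X Y y a ai b al ali Fi) (k l : Fin n) : al * Y k (Y l al) = a l k - Y k al * Y l al := by
  have := congrArg (Y k) (h.alY l)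
  rw [D_mul, h.Yyl] at this
  linear_combination this

theorem a_contr (h : RData X Y y a ai b al ali Fi) (f : Fin n → A) (m : Fin n) : ∑ k, a m k * ∑ l, ai k l * f l = f m := by
  simp only [Finset.mul_sum]
  rw [Finset.sum_comm]
  have : ∀ l, ∑ k, a m k * (ai k l * f l) = (if m = l then 1 else 0) * f l := by
    intro l
    rw [← h.aai, Finset.sum_mul]; exact Finset.sum_congr rfl fun _ _ => by ring
  simp [this]

theorem a_Ga (h : RData X Y y a ai b al ali Fi) (m : Fin n) : 4 * ∑ k, a m k * Ga X Y y ai al k = rho X Y y al m := by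
  rw [← h.a_contr (rho X Y y al) m]
  rw [Finset.mul_sum]
  refine Finset.sum_congr rfl fun k _ => ?_
  rw [Ga]
  linear_combination (a m k * ∑ l, ai k l * rho X Y y al l) * (2 * hf2 A + 1) * (two_hf (A := A))

theorem ELa (h : RData X Y y a ai b al ali Fi) (l : Fin n) : Sp X Y y (Ga X Y y ai al) (Y l (al * al)) = X l (al * al) := by
  have := h.a_Ga l
  rw [rho] at this
  rw [Sp_apply]
  have e : 2 * ∑ k, Ga X Y y ai al k * Y k (Y l (al * al)) = 4 * ∑ k, a l k * Ga X Y y ai al k := by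
    simp only [h.YYsq, Finset.mul_sum]
    exact Finset.sum_congr rfl fun _ _ => by ring
  rw [e, this]; ring

theorem Eu_y (h : RData X Y y a ai b al ali Fi) (k : Fin n) : Eu Y y (y k) = y k := by
  rw [Eu_apply]; simp [h.fr.Yy]

theorem Eu_base (h : RData X Y y a ai b al ali Fi) {f : A} (hfY : ∀ k, Y k f = 0) : Eu Y y f = 0 := by
  rw [Eu_apply]; simp [hfY]

theorem EuGa (h : RData X Y y a ai b al ali Fi) (k : Fin n) : Eu Y y (Ga X Y y ai al k) = 2 * Ga X Y y ai al k := by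
  have hr : ∀ l, Eu Y y (rho X Y y al l) = 2 * rho X Y y al l := by
    intro l
    rw [rho, map_sub, map_sum, Eu_X h.fr, h.Eusq, D_two]
    have : ∀ k, Eu Y y (y k * X k (Y l (al * al))) = 2 * (y k * X k (Y l (al * al))) := by
      intro k
      rw [D_mul, h.Eu_y, Eu_X h.fr, Eu_Y h.fr, h.Eusq, D_two, map_sub, D_two]; ring
    simp only [this, ← Finset.mul_sum]
    ring
  rw [Ga, D_hf, D_hf, map_sum]
  have : ∀ l, Eu Y y (ai k l * rho X Y y al l) = 2 * (ai k l * rho X Y y al l) := by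
    intro l
    rw [D_mul, hr, h.Eu_base (fun j => h.Yai j k l)]; ring
  simp only [this, ← Finset.mul_sum]
  ring

theorem SGal (h : RData X Y y a ai b al ali Fi) : Sp X Y y (Ga X Y y ai al) al = 0 := by
  have := SpL h.fr _ _ h.Eusq h.ELa
  rw [D_mul] at this
  have e : al * Sp X Y y (Ga X Y y ai al) al = 0 := by
    apply cancel_two; linear_combination this
  linear_combination ali * e - (Sp X Y y (Ga X Y y ai al) al) * h.hali

theorem ELal (h : RData X Y y a ai b al ali Fi) (l : Fin n) : Sp X Y y (Ga X Y y ai al) (Y l al) = X l al := by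
  have := h.ELa l
  rw [D_mul, D_mul, map_add, D_mul, D_mul, h.SGal] at this
  have e : al * Sp X Y y (Ga X Y y ai al) (Y l al) = al * X l al := by
    apply cancel_two; linear_combination this
  linear_combination ali * e - (Sp X Y y (Ga X Y y ai al) (Y l al) - X l al) * h.hali

theorem Ycc (h : RData X Y y a ai b al ali Fi) (m k l : Fin n) : Y m (cc X b k l) = 0 := by
  rw [cc, map_sub, h.fr.XY, h.fr.XY, h.Yb, h.Yb]; simp

theorem Yss (h : RData X Y y a ai b al ali Fi) (m k l : Fin n) : Y m (ss X ai b k l) = 0 := by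
  rw [ss, map_sum]; simp [h.Ycc, h.Yai]

theorem Ysv (h : RData X Y y a ai b al ali Fi) (k i : Fin n) : Y k (sv X y ai b i) = ss X ai b i k :=
  Y_base_y h.fr (ss X ai b i) (fun m l => h.Yss m i l) k

theorem cc_anti (k l : Fin n) : cc X b k l = - cc X b l k := by simp [cc]

theorem a_ss (h : RData X Y y a ai b al ali Fi) (m k : Fin n) : ∑ i, a m i * ss X ai b i k = cc X b k m := h.a_contr _ m

theorem a_sv (h : RData X Y y a ai b al ali Fi) (m : Fin n) : ∑ i, a m i * sv X y ai b i = ∑ k, cc X b k m * y k := by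
  simp only [sv, Finset.mul_sum]
  rw [Finset.sum_comm]
  refine Finset.sum_congr rfl fun k _ => ?_
  rw [← h.a_ss, Finset.sum_mul]
  exact Finset.sum_congr rfl fun _ _ => by ring

theorem sv_yl (h : RData X Y y a ai b al ali Fi) : ∑ i, sv X y ai b i * yl y a i = 0 := by
  have e : ∑ i, sv X y ai b i * yl y a i = ∑ m, ∑ k, cc X b k m * y k * y m := by
    simp only [yl, Finset.mul_sum]
    rw [Finset.sum_comm]
    refine Finset.sum_congr rfl fun m _ => ?_
    rw [← Finset.sum_mul, ← h.a_sv, Finset.sum_mul]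
    exact Finset.sum_congr rfl fun i _ => by rw [h.asymm i m]; ring
  have e2 : ∑ m, ∑ k, cc X b k m * y k * y m = - ∑ m, ∑ k, cc X b k m * y k * y m := by
    conv_lhs => rw [Finset.sum_comm]
    rw [← Finset.sum_neg_distrib]
    refine Finset.sum_congr rfl fun k _ => ?_
    rw [← Finset.sum_neg_distrib]
    refine Finset.sum_congr rfl fun l _ => ?_
    rw [cc_anti]; ring
  rw [e]
  apply cancel_two
  linear_combination e2

theorem EuBq (h : RData X Y y a ai b al ali Fi) (i : Fin n) : Eu Y y (Bq X y ai b al i) = 2 * Bq X y ai b al i := by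
  have : Eu Y y (sv X y ai b i) = sv X y ai b i := by
    rw [Eu_apply]; simp only [h.Ysv]; exact Finset.sum_congr rfl fun _ _ => by ring
  rw [Bq, D_hf, D_mul, h.Eual, this]; ring

theorem EuG0 (h : RData X Y y a ai b al ali Fi) (i : Fin n) : Eu Y y (G0 X Y y ai b al i) = 2 * G0 X Y y ai b al i := by
  rw [G0, map_add, h.EuBq, h.EuGa]; ring

theorem Sp_G0 (f : A) : Sp X Y y (G0 X Y y ai b al) f = Sp X Y y (Ga X Y y ai al) f
    - 2 * ∑ k, Bq X y ai b al k * Y k f := by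
  rw [Sp_apply, Sp_apply]
  simp only [G0, add_mul, Finset.sum_add_distrib]; ring

theorem two_Bq_Yal (h : RData X Y y a ai b al ali Fi) (l : Fin n) : 2 * ∑ k, Bq X y ai b al k * Y k (Y l al)
    = ∑ k, cc X b k l * y k := by
  have e : ∀ k, 2 * (Bq X y ai b al k * Y k (Y l al)) = a l k * sv X y ai b k
     - ali * Y l al * (sv X y ai b k * yl y a k) := by
    intro k
    have h1 := h.alYY k l
    have h2 := h.Yal k
    rw [Bq]
    rw [h2] at h1
    linear_combination (sv X y ai b k) * h1 + (al * sv X y ai b k * Y k (Y l al)) * (two_hf (A := A))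
  rw [Finset.mul_sum]
  simp only [e, Finset.sum_sub_distrib, ← Finset.mul_sum]
  rw [h.sv_yl, h.a_sv]; ring

theorem YF (h : RData X Y y a ai b al ali Fi) (l : Fin n) : Y l (al + ∑ i, b i * y i) = Y l al + b l := by
  rw [map_add, Y_base_y h.fr b h.Yb]

theorem EuF (h : RData X Y y a ai b al ali Fi) : Eu Y y (al + ∑ i, b i * y i) = al + ∑ i, b i * y i := by
  rw [map_add, h.Eual, Eu_apply]
  simp only [Y_base_y h.fr b h.Yb]
  congr 1
  exact Finset.sum_congr rfl fun _ _ => by ring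

theorem EL0 (h : RData X Y y a ai b al ali Fi) (l : Fin n) : Sp X Y y (G0 X Y y ai b al) (Y l (al + ∑ i, b i * y i))
    = X l (al + ∑ i, b i * y i) := by
  rw [h.YF, Sp_G0, map_add, h.ELal]
  have e1 : ∑ k, Bq X y ai b al k * Y k (Y l al + b l) = ∑ k, Bq X y ai b al k * Y k (Y l al) :=
    Finset.sum_congr rfl fun k _ => by rw [map_add, h.Yb, add_zero]
  have e2 : Sp X Y y (Ga X Y y ai al) (b l) = ∑ k, y k * X k (b l) := by
    rw [Sp_apply]; simp [h.Yb]
  have e3 : X l (∑ i, b i * y i) = ∑ i, X l (b i) * y i := by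
    rw [map_sum]; simp [h.fr.Xy, mul_comm]
  rw [e1, h.two_Bq_Yal, e2, map_add, e3]
  simp only [cc, sub_mul, Finset.sum_sub_distrib]
  have : ∑ k, y k * X k (b l) = ∑ k, X k (b l) * y k := Finset.sum_congr rfl fun _ _ => mul_comm _ _
  rw [this]; ring

theorem EuFi (h : RData X Y y a ai b al ali Fi) : Eu Y y Fi = - Fi := by
  have e := congrArg (Eu Y y) h.hFi
  rw [D_mul, h.EuF, Derivation.map_one_eq_zero] at e
  linear_combination Fi * e - (Eu Y y Fi + Fi) * h.hFi

theorem Eu_Sp (h : RData X Y y a ai b al ali Fi) (G : Fin n → A) (hG : ∀ i, Eu Y y (G i) = 2 * G i) (f : A) :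
    Eu Y y (Sp X Y y G f) = Sp X Y y G (Eu Y y f) + Sp X Y y G f := by
  simp only [← sum_y_dl G hG, map_sum, D_mul, Eu_dl h.fr G hG, h.Eu_y, Finset.sum_add_distrib]

theorem EuPf (h : RData X Y y a ai b al ali Fi) : Eu Y y (Pf X Y y ai b al Fi) = Pf X Y y ai b al Fi := by
  rw [Pf, D_hf, D_mul, h.EuFi, h.Eu_Sp _ h.EuG0, h.EuF]; ring

theorem EuGR (h : RData X Y y a ai b al ali Fi) (i : Fin n) : Eu Y y (GR X Y y ai b al Fi i) = 2 * GR X Y y ai b al Fi i := by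
  rw [GR, map_add, D_mul, h.EuG0, h.EuPf, h.Eu_y]; ring

theorem Sp_GR (f : A) : Sp X Y y (GR X Y y ai b al Fi) f = Sp X Y y (G0 X Y y ai b al) f
    - 2 * Pf X Y y ai b al Fi * Eu Y y f := by
  rw [Sp_apply, Sp_apply, Eu_apply, Finset.mul_sum, Finset.mul_sum, Finset.mul_sum, sub_sub,
    ← Finset.sum_add_distrib]
  congr 1
  exact Finset.sum_congr rfl fun _ _ => by rw [GR]; ring

theorem ELR (h : RData X Y y a ai b al ali Fi) (l : Fin n) :
    Sp X Y y (GR X Y y ai b al Fi) (Y l ((al + ∑ i, b i * y i) * (al + ∑ i, b i * y i)))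
      = X l ((al + ∑ i, b i * y i) * (al + ∑ i, b i * y i)) := by
  have h1 : Sp X Y y (GR X Y y ai b al Fi) (al + ∑ i, b i * y i) = 0 := by
    rw [Sp_GR, h.EuF, Pf]
    linear_combination (-(Sp X Y y (G0 X Y y ai b al) (al + ∑ i, b i * y i))) *
      (h.hFi * (2 * hf2 A) + (two_hf (A := A)))
  have h2 : Sp X Y y (GR X Y y ai b al Fi) (Y l (al + ∑ i, b i * y i)) =
      X l (al + ∑ i, b i * y i) := by
    rw [Sp_GR, Eu_Y h.fr, h.EuF, h.EL0]; ring
  rw [D_mul, D_mul, map_add, D_mul, D_mul, h1, h2]; ring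

theorem EuFsq (h : RData X Y y a ai b al ali Fi) : Eu Y y ((al + ∑ i, b i * y i) * (al + ∑ i, b i * y i))
    = 2 * ((al + ∑ i, b i * y i) * (al + ∑ i, b i * y i)) := by
  rw [D_mul, h.EuF]; ring

end RData

end Alg2

section Alg3
variable {n : ℕ} {A : Type*} [CommRing A] [Algebra ℝ A]
variable {X Y : Fin n → Derivation ℝ A A} {y : Fin n → A}

/-- quadratic part of the curvature operator. -/
def qBB (Y : Fin n → Derivation ℝ A A) (B : Fin n → A) (i k : Fin n) : A :=
  2 * (∑ j, B j * Y j (Y k (B i))) - ∑ j, Y j (B i) * Y k (B j)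

theorem σ_Ru (σ : A →ₐ[ℝ] A)
    (hX : ∀ k f, σ (X k f) = X k (σ f)) (hY : ∀ k f, σ (Y k f) = - Y k (σ f))
    (hy : ∀ k, σ (y k) = - y k) (G : Fin n → A) (i k : Fin n) :
    σ (Ru X Y y G i k) = Ru X Y y (fun i => σ (G i)) i k := by
  simp only [Ru, map_add, map_sub, map_sum, map_mul, hX, hY, hy, map_neg, neg_neg, map_ofNat,
    neg_mul_neg]

theorem Ru_parity0 (G B : Fin n → A) (i k : Fin n) :
    Ru X Y y (fun i => G i + B i) i k + Ru X Y y (fun i => G i + - B i) i k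
      = 2 * Ru X Y y G i k + 2 * qBB Y B i k := by
  simp only [Ru, qBB, map_add, map_neg, mul_add, add_mul, Finset.sum_add_distrib, mul_neg, neg_mul,
    Finset.sum_neg_distrib]
  ring

theorem Ru_parity (σ : A →ₐ[ℝ] A)
    (hX : ∀ k f, σ (X k f) = X k (σ f)) (hY : ∀ k f, σ (Y k f) = - Y k (σ f))
    (hy : ∀ k, σ (y k) = - y k) (G B : Fin n → A) (hG : ∀ i, σ (G i) = G i)
    (hB : ∀ i, σ (B i) = - B i) (i k : Fin n) :
    Ru X Y y (fun i => G i + B i) i k + σ (Ru X Y y (fun i => G i + B i) i k)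
      = 2 * Ru X Y y G i k + 2 * qBB Y B i k := by
  rw [σ_Ru σ hX hY hy, ← Ru_parity0]
  simp only [map_add, hG, hB]

variable {a ai : Fin n → Fin n → A} {b : Fin n → A} {al ali Fi : A}

namespace RData

theorem ss_yl (h : RData X Y y a ai b al ali Fi) (k : Fin n) :
    ∑ j, yl y a j * ss X ai b j k = - ∑ m, cc X b m k * y m := by
  have : ∀ j, yl y a j * ss X ai b j k = ∑ m, y m * (a m j * ss X ai b j k) := by
    intro j
    rw [yl, Finset.sum_mul]
    exact Finset.sum_congr rfl fun m _ => by rw [h.asymm]; ring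
  rw [Finset.sum_congr rfl fun j _ => this j, Finset.sum_comm]
  simp only [← Finset.mul_sum, h.a_ss]
  rw [← Finset.sum_neg_distrib]
  exact Finset.sum_congr rfl fun m _ => by rw [cc_anti k m]; ring

theorem Bq_Yal (h : RData X Y y a ai b al ali Fi) :
    ∑ j, Bq X y ai b al j * Y j al = 0 := by
  have : ∀ j, Bq X y ai b al j * Y j al = hf2 A * (sv X y ai b j * yl y a j) := by
    intro j
    rw [Bq, ← h.alY]; ring
  rw [Finset.sum_congr rfl fun j _ => this j, ← Finset.mul_sum, h.sv_yl, mul_zero]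

theorem YBq (h : RData X Y y a ai b al ali Fi) (k i : Fin n) :
    Y k (Bq X y ai b al i) = hf2 A * (al * ss X ai b i k + Y k al * sv X y ai b i) := by
  rw [Bq, D_hf, D_mul, h.Ysv]

theorem YYBq (h : RData X Y y a ai b al ali Fi) (j k i : Fin n) :
    Y j (Y k (Bq X y ai b al i)) = hf2 A * (Y j al * ss X ai b i k + Y k al * ss X ai b i j
      + Y j (Y k al) * sv X y ai b i) := by
  rw [h.YBq, D_hf, map_add, D_mul, D_mul, h.Ysv, h.Yss]; ring

/-- formula for the quadratic term. -/
theorem qBB_eq (h : RData X Y y a ai b al ali Fi) :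
    ∃ Z : Fin n → A, ∀ i k, qBB Y (Bq X y ai b al) i k =
      (hf2 A + hf2 A * hf2 A) * (∑ m, cc X b m k * y m) * sv X y ai b i
      - hf2 A * hf2 A * (al * al) * (∑ j, ss X ai b i j * ss X ai b j k) + Y k al * Z i := by
  refine ⟨fun i => hf2 A * (2 * ∑ j, Bq X y ai b al j * ss X ai b i j)
      - hf2 A * hf2 A * (∑ j, al * (ss X ai b i j * sv X y ai b j)
          + ∑ j, Y j al * (sv X y ai b j * sv X y ai b i)), fun i k => ?_⟩
  have e1 : 2 * (∑ j, Bq X y ai b al j * Y j (Y k (Bq X y ai b al i)))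
     = hf2 A * (ss X ai b i k * (2 * ∑ j, Bq X y ai b al j * Y j al)
        + Y k al * (2 * ∑ j, Bq X y ai b al j * ss X ai b i j)
        + sv X y ai b i * (2 * ∑ j, Bq X y ai b al j * Y j (Y k al))) := by
    simp only [h.YYBq, Finset.mul_sum, ← Finset.sum_add_distrib]
    exact Finset.sum_congr rfl fun _ _ => by ring
  have e2 : ∑ j, Y j (Bq X y ai b al i) * Y k (Bq X y ai b al j)
     = hf2 A * hf2 A * (al * al * (∑ j, ss X ai b i j * ss X ai b j k)
       + Y k al * (∑ j, al * (ss X ai b i j * sv X y ai b j)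
          + ∑ j, Y j al * (sv X y ai b j * sv X y ai b i))
       + sv X y ai b i * (∑ j, yl y a j * ss X ai b j k)) := by
    simp only [h.YBq, Finset.mul_sum, mul_add, ← Finset.sum_add_distrib]
    exact Finset.sum_congr rfl fun j _ => by rw [← h.alY j]; ring
  rw [qBB, e1, e2, h.Bq_Yal, h.two_Bq_Yal, h.ss_yl]
  ring

theorem a_qBB (h : RData X Y y a ai b al ali Fi) :
    ∃ Z : Fin n → A, ∀ m k, ∑ i, a m i * qBB Y (Bq X y ai b al) i k =
      (hf2 A + hf2 A * hf2 A) * (∑ j, cc X b j k * y j) * (∑ j, cc X b j m * y j)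
      - hf2 A * hf2 A * (al * al) * (∑ j, cc X b j m * ss X ai b j k) + Y k al * Z m := by
  obtain ⟨Z, hZ⟩ := h.qBB_eq
  refine ⟨fun m => ∑ i, a m i * Z i, fun m k => ?_⟩
  have e2 : ∑ j, cc X b j m * ss X ai b j k = ∑ i, a m i * ∑ j, ss X ai b i j * ss X ai b j k := by
    simp only [← h.a_ss, Finset.mul_sum, Finset.sum_mul]
    rw [Finset.sum_comm]
    exact Finset.sum_congr rfl fun _ _ => Finset.sum_congr rfl fun _ _ => by ring
  simp only [hZ]
  rw [e2, ← h.a_sv m]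
  simp only [Finset.mul_sum (a := Y k al), Finset.mul_sum (s := Finset.univ) (f := fun i => a m i * sv X y ai b i), Finset.mul_sum (s := Finset.univ) (f := fun i => a m i * ∑ j, ss X ai b i j * ss X ai b j k)]
  rw [← Finset.sum_sub_distrib, ← Finset.sum_add_distrib]
  exact Finset.sum_congr rfl fun _ _ => by ring

theorem σ_Ga (σ : A →ₐ[ℝ] A)
    (hX : ∀ k f, σ (X k f) = X k (σ f)) (hY : ∀ k f, σ (Y k f) = - Y k (σ f))
    (hy : ∀ k, σ (y k) = - y k) (hai : ∀ i j, σ (ai i j) = ai i j) (hal : σ al = al) (i : Fin n) :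
    σ (Ga X Y y ai al i) = Ga X Y y ai al i := by
  simp only [Ga, rho, hf2, map_sub, map_sum, map_mul, AlgHom.commutes, hX, hY, hy, hai, hal,
    map_neg, neg_mul_neg]

theorem σ_Bq (σ : A →ₐ[ℝ] A)
    (hX : ∀ k f, σ (X k f) = X k (σ f))
    (hy : ∀ k, σ (y k) = - y k) (hai : ∀ i j, σ (ai i j) = ai i j) (hb : ∀ i, σ (b i) = b i)
    (hal : σ al = al) (i : Fin n) :
    σ (Bq X y ai b al i) = - Bq X y ai b al i := by
  simp only [Bq, sv, ss, cc, hf2, map_sub, map_sum, map_mul, AlgHom.commutes, hX, hy, hai,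
    hal, hb, mul_neg, Finset.sum_neg_distrib]

/-- the combined formula. -/
theorem combined (h : RData X Y y a ai b al ali Fi) (σ : A →ₐ[ℝ] A)
    (hX : ∀ k f, σ (X k f) = X k (σ f)) (hY : ∀ k f, σ (Y k f) = - Y k (σ f))
    (hy : ∀ k, σ (y k) = - y k) (hai : ∀ i j, σ (ai i j) = ai i j) (hb : ∀ i, σ (b i) = b i)
    (hal : σ al = al) :
    ∃ (Z τ : Fin n → A) (Ξ : A), ∀ m k, ∑ i, a m i * (Ru X Y y (GR X Y y ai b al Fi) i k
        + σ (Ru X Y y (GR X Y y ai b al Fi) i k)) =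
      2 * (∑ i, a m i * Ru X Y y (Ga X Y y ai al) i k)
      + 2 * ((hf2 A + hf2 A * hf2 A) * (∑ j, cc X b j k * y j) * (∑ j, cc X b j m * y j)
      - hf2 A * hf2 A * (al * al) * (∑ j, cc X b j m * ss X ai b j k)) + Y k al * Z m
      + a m k * Ξ + τ k * yl y a m := by
  obtain ⟨Z, hZ⟩ := h.a_qBB
  obtain ⟨Ξ, τ, hP⟩ := Ru_proj h.fr (G0 X Y y ai b al) h.EuG0 (Pf X Y y ai b al Fi) h.EuPf
  refine ⟨fun m => 2 * Z m, fun k => τ k - σ (τ k), Ξ + σ Ξ, fun m k => ?_⟩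
  have e0 : ∀ i, Ru X Y y (GR X Y y ai b al Fi) i k + σ (Ru X Y y (GR X Y y ai b al Fi) i k)
     = 2 * Ru X Y y (Ga X Y y ai al) i k + 2 * qBB Y (Bq X y ai b al) i k
       + (if i = k then Ξ + σ Ξ else 0) + (τ k - σ (τ k)) * y i := by
    intro i
    rw [← Ru_parity σ hX hY hy (Ga X Y y ai al) (Bq X y ai b al)
      (σ_Ga σ hX hY hy hai hal) (σ_Bq σ hX hy hai hb hal)]
    have e1 : Ru X Y y (GR X Y y ai b al Fi) i k = Ru X Y y (fun i => Ga X Y y ai al i + Bq X y ai b al i) i k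
       + (if i = k then Ξ else 0) + τ k * y i := hP i k
    rw [e1, map_add, map_add, map_mul, hy]
    split_ifs <;> simp <;> ring
  simp only [e0, mul_add, Finset.sum_add_distrib]
  have t1 : ∑ i, a m i * (2 * Ru X Y y (Ga X Y y ai al) i k) = 2 * ∑ i, a m i * Ru X Y y (Ga X Y y ai al) i k := by
    rw [Finset.mul_sum]; exact Finset.sum_congr rfl fun _ _ => by ring
  have t2 : ∑ i, a m i * (2 * qBB Y (Bq X y ai b al) i k) = 2 * ∑ i, a m i * qBB Y (Bq X y ai b al) i k := by
    rw [Finset.mul_sum]; exact Finset.sum_congr rfl fun _ _ => by ring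
  have t3 : ∑ i, a m i * ((τ k - σ (τ k)) * y i) = (τ k - σ (τ k)) * yl y a m := by
    rw [yl, Finset.mul_sum]; exact Finset.sum_congr rfl fun _ _ => by ring
  rw [t1, t2, t3, hZ]
  simp
  ring

/-- third vertical derivative of the Riemannian spray vanishes. -/
theorem YYYGa (h : RData X Y y a ai b al ali Fi) (i j k l : Fin n) :
    Y i (Y j (Y k (Ga X Y y ai al l))) = 0 := by
  have hr : ∀ l, Y i (Y j (Y k (rho X Y y al l))) = 0 := by
    intro l
    have e : ∀ k f, Y k (∑ m, y m * X m f) = X k f + ∑ m, y m * X m (Y k f) := by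
      intro k f
      rw [map_sum]
      simp only [D_mul, h.fr.Yy, h.fr.XY, Finset.sum_add_distrib]
      simp
      ring
    have z : ∀ i j k, Y i (Y j (Y k (al * al))) = 0 := by
      intro i j k
      rw [h.YYsq, D_two, h.Ya, mul_zero]
    rw [rho, map_sub, e, map_sub, map_add, e, map_sub, map_add, map_add, e]
    simp only [h.fr.XY, z, map_zero, mul_zero, Finset.sum_const_zero, add_zero, sub_zero]
  have e2 : ∀ i (f : Fin n → A), Y i (∑ m, ai l m * f m) = ∑ m, ai l m * Y i (f m) := by
    intro i f
    rw [map_sum]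
    exact Finset.sum_congr rfl fun m _ => by rw [D_mul, h.Yai]; ring
  rw [Ga]
  simp only [D_hf, e2, hr, mul_zero, Finset.sum_const_zero]

theorem YYRc (h : RData X Y y a ai b al ali Fi) (q m i k l : Fin n) :
    Y q (Y m (Rc X Y (Ga X Y y ai al) i k l)) = 0 := by
  rw [Y_Rc h.fr, map_sub, map_sub, map_sub, Y_dl h.fr, Y_dl h.fr, map_sum, map_sum]
  simp only [D_mul, h.YYYGa, map_zero, mul_zero, zero_mul, add_zero, Finset.sum_const_zero, sub_zero]

/-- Riemannian curvature four-tensor. -/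
def c4 (X Y : Fin n → Derivation ℝ A A) (y : Fin n → A) (a ai : Fin n → Fin n → A) (al : A)
    (m q k l : Fin n) : A := ∑ i, a m i * Y q (Rc X Y (Ga X Y y ai al) i k l)

theorem Yc4 (h : RData X Y y a ai b al ali Fi) (r m q k l : Fin n) :
    Y r (c4 X Y y a ai al m q k l) = 0 := by
  rw [c4, map_sum]
  simp only [D_mul, h.YYRc, h.Ya, mul_zero, zero_mul, add_zero, Finset.sum_const_zero]

theorem c4_anti2 (m q k l : Fin n) :
    c4 X Y y a ai al m q k l = - c4 X Y y a ai al m q l k := by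
  rw [c4, c4, ← Finset.sum_neg_distrib]
  exact Finset.sum_congr rfl fun i _ => by rw [Rc_anti, map_neg]; ring

theorem c4_anti1 (h : RData X Y y a ai b al ali Fi) (m q k l : Fin n) :
    c4 X Y y a ai al m q k l = - c4 X Y y a ai al q m k l := by
  have h1 := uRc h.fr (Ga X Y y ai al) (al * al) h.Eusq h.ELa k l
  simp only [h.Ysq] at h1
  have h2 := congrArg (Y q) (congrArg (Y m) h1)
  simp only [map_sum, D_mul, map_add, map_zero] at h2
  have d2 : ∀ q, Y q (2 : A) = 0 := fun q => by
    rw [← map_ofNat (algebraMap ℝ A) 2, Derivation.map_algebraMap]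
  simp only [h.YYRc, h.Yyl, d2, map_zero, h.Ya, mul_zero, zero_mul, add_zero, zero_add] at h2
  apply cancel_two
  rw [eq_comm, ← sub_eq_zero, ← neg_eq_zero, ← h2, c4, c4, ← Finset.sum_neg_distrib,
    Finset.mul_sum, Finset.mul_sum,
    ← Finset.sum_sub_distrib, ← Finset.sum_neg_distrib]
  refine Finset.sum_congr rfl fun i _ => ?_
  rw [h.asymm m i, h.asymm q i]
  ring

theorem a_Ru (h : RData X Y y a ai b al ali Fi) (m k : Fin n) :
    ∑ i, a m i * Ru X Y y (Ga X Y y ai al) i k = ∑ l, ∑ q, y l * y q * c4 X Y y a ai al m q k l := by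
  have e : ∀ i, Ru X Y y (Ga X Y y ai al) i k
      = ∑ l, ∑ q, y l * y q * Y q (Rc X Y (Ga X Y y ai al) i k l) := by
    intro i
    rw [Ru_eq h.fr _ h.EuGa]
    refine Finset.sum_congr rfl fun l _ => ?_
    rw [← Eu_Rc h.fr _ h.EuGa i k l, Eu_apply, Finset.mul_sum]
    refine Finset.sum_congr rfl fun q _ => ?_
    rw [← Eu_apply, Eu_Rc h.fr _ h.EuGa]; ring
  simp only [e, c4, Finset.mul_sum]
  rw [Finset.sum_comm]
  refine Finset.sum_congr rfl fun l _ => ?_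
  rw [Finset.sum_comm]
  exact Finset.sum_congr rfl fun q _ => Finset.sum_congr rfl fun i _ => by ring

end RData
end Alg3

section LinAlg
variable {V : Type*} [AddCommGroup V] [Module ℝ V]

/-- data at one point used to show that the flag curvature is isotropic. -/
structure PtData (ip : V →ₗ[ℝ] V →ₗ[ℝ] ℝ) (β : V →ₗ[ℝ] ℝ) (Kf ω : V → V → ℝ) (σ Ξ : V → ℝ) :
    Prop where
  symm : ∀ u v, ip u v = ip v u
  pos : ∀ v, v ≠ 0 → 0 < ip v v
  hK : ∀ (y v : V) (p q r s : ℝ), LinearIndependent ℝ ![y, v] → p * s - q * r ≠ 0 →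
    Kf (p • y + q • v) (r • y + s • v) = Kf y v
  wsymm : ∀ u v, ω u v = ω v u
  wdet : ∀ (y v : V) (p q r s : ℝ), ω (p • y + q • v) (r • y + s • v) = (p * s - q * r) ^ 2 * ω y v
  wquad : ∀ y u v, ∃ W : ℝ, ∀ c s : ℝ, ω y (c • u + s • v) = c ^ 2 * ω y u + s ^ 2 * ω y v + c * s * W
  squad : ∀ u v, ∃ W : ℝ, ∀ c s : ℝ, σ (c • u + s • v) = c ^ 2 * σ u + s ^ 2 * σ v + c * s * W
  hE : ∀ y p, ip y y = 1 → ip p p = 1 → ip y p = 0 →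
    (1 + β y ^ 2) * Kf y p = ω y p + σ p + Ξ y

namespace PtData
variable {ip : V →ₗ[ℝ] V →ₗ[ℝ] ℝ} {β : V →ₗ[ℝ] ℝ} {Kf ω : V → V → ℝ} {σ Ξ : V → ℝ}

theorem li (h : PtData ip β Kf ω σ Ξ) {u v : V} (hu : ip u u = 1) (hv : ip v v = 1)
    (huv : ip u v = 0) : LinearIndependent ℝ ![u, v] := by
  rw [LinearIndependent.pair_iff]
  intro s t hst
  have h1 : ip u (s • u + t • v) = 0 := by rw [hst]; simp
  have h2 : ip v (s • u + t • v) = 0 := by rw [hst]; simp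
  rw [map_add, map_smul, map_smul, smul_eq_mul, smul_eq_mul] at h1 h2
  rw [h.symm v u] at h2
  rw [hu, huv] at h1
  rw [hv, huv] at h2
  constructor <;> linarith

theorem Ksymm (h : PtData ip β Kf ω σ Ξ) {u v : V} (hl : LinearIndependent ℝ ![u, v]) :
    Kf v u = Kf u v := by
  have := h.hK u v 0 1 1 0 hl (by norm_num)
  simpa using this

set_option maxHeartbeats 1000000 in
/-- three orthonormal vectors, the first one dual to `β`. -/
theorem triple (h : PtData ip β Kf ω σ Ξ) {e1 e2 e3 : V} (h11 : ip e1 e1 = 1) (h22 : ip e2 e2 = 1)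
    (h33 : ip e3 e3 = 1) (h12 : ip e1 e2 = 0) (h13 : ip e1 e3 = 0) (h23 : ip e2 e3 = 0)
    (hb1 : β e1 ≠ 0) (hb2 : β e2 = 0) (hb3 : β e3 = 0) :
    Kf e2 e3 = Kf e1 e3 ∧ ∀ c s : ℝ, c ^ 2 + s ^ 2 = 1 → Kf e3 (c • e1 + s • e2) = Kf e1 e3 := by
  have h21 : ip e2 e1 = 0 := by rw [h.symm, h12]
  have h31 : ip e3 e1 = 0 := by rw [h.symm, h13]
  have h32 : ip e3 e2 = 0 := by rw [h.symm, h23]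
  have ipc : ∀ c s c' s' : ℝ, ip (c • e1 + s • e2) (c' • e1 + s' • e2) = c * c' + s * s' := by
    intro c s c' s'
    simp [h11, h22, h12, h21]
  have ip3 : ∀ c s : ℝ, ip (c • e1 + s • e2) e3 = 0 := by
    intro c s; simp [h13, h23]
  have ip3' : ∀ c s : ℝ, ip e3 (c • e1 + s • e2) = 0 := by
    intro c s; rw [h.symm, ip3]
  set b := β e1 with hb
  set r : ℝ := Real.sqrt (1 / 2) with hr
  have hr2 : r ^ 2 = 1 / 2 := Real.sq_sqrt (by norm_num)
  have m1 : r * r = 1 / 2 := by rw [← sq, hr2]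
  set yp := r • e1 + r • e2 with hyp
  set ym := r • e1 + (-r) • e2 with hym
  have bp : β yp = r * b := by simp [hyp, hb2, hb]
  have bm : β ym = r * b := by simp [hym, hb2, hb]
  have ipp : ip yp yp = 1 := by rw [hyp, ipc]; linarith
  have imm : ip ym ym = 1 := by rw [hym, ipc]; linarith
  have ipm : ip yp ym = 0 := by rw [hyp, hym, ipc]; ring
  have imp : ip ym yp = 0 := by rw [h.symm, ipm]
  have A1 := h.hE e2 e1 h22 h11 h21
  have A2 := h.hE e2 e3 h22 h33 h23
  have A3 := h.hE e3 e1 h33 h11 h31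
  have A4 := h.hE e3 e2 h33 h22 h32
  have A5 := h.hE e1 e2 h11 h22 h12
  have A6 := h.hE e1 e3 h11 h33 h13
  have A7 := h.hE yp ym ipp imm ipm
  have A8 := h.hE ym yp imm ipp imp
  have A9 := h.hE yp e3 ipp h33 (ip3 _ _)
  have A10 := h.hE ym e3 imm h33 (ip3 _ _)
  have A11 := h.hE e3 yp h33 ipp (ip3' _ _)
  have A12 := h.hE e3 ym h33 imm (ip3' _ _)
  have l12 := h.li h11 h22 h12
  have k1 : Kf e2 e1 = Kf e1 e2 := h.Ksymm l12
  have k2 : Kf e3 e1 = Kf e1 e3 := h.Ksymm (h.li h11 h33 h13)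
  have k3 : Kf e3 e2 = Kf e2 e3 := h.Ksymm (h.li h22 h33 h23)
  have k4 : Kf yp e3 = Kf e3 yp := h.Ksymm (h.li h33 ipp (ip3' _ _))
  have k5 : Kf ym e3 = Kf e3 ym := h.Ksymm (h.li h33 imm (ip3' _ _))
  have k6 : Kf yp ym = Kf e1 e2 := h.hK e1 e2 r r r (-r) l12 (by rw [mul_neg, m1]; norm_num)
  have k7 : Kf ym yp = Kf e1 e2 := h.hK e1 e2 r (-r) r r l12 (by rw [neg_mul, m1]; norm_num)
  have w7 : ω yp ym = ω e1 e2 := by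
    rw [hyp, hym, h.wdet]
    have : (r * -r - r * r) ^ 2 = 1 := by
      have : r * -r - r * r = -1 := by rw [mul_neg, m1]; norm_num
      rw [this]; norm_num
    rw [this, one_mul]
  have w8 : ω ym yp = ω e1 e2 := by rw [h.wsymm, w7]
  obtain ⟨W, hW⟩ := h.wquad e3 e1 e2
  obtain ⟨S, hS⟩ := h.squad e1 e2
  have wp := hW r r
  have wm := hW r (-r)
  have sp := hS r r
  have sm := hS r (-r)
  rw [← hyp] at wp sp
  rw [← hym] at wm sm
  rw [k1, hb2, h.wsymm e2 e1] at A1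
  rw [hb2, h.wsymm e2 e3] at A2
  rw [k2, hb3] at A3
  rw [k3, hb3] at A4
  rw [h.wsymm e1 e3] at A6
  rw [k6, bp, w7] at A7
  rw [k7, bm, w8] at A8
  rw [k4, bp, h.wsymm yp e3] at A9
  rw [k5, bm, h.wsymm ym e3] at A10
  rw [hb3] at A11 A12
  rw [← hb] at A5 A6
  have r2 : (r * b) ^ 2 = b ^ 2 / 2 := by rw [mul_pow, hr2]; ring
  rw [r2] at A7 A8 A9 A10
  have m2 : r * -r = - (1 / 2) := by rw [mul_neg, m1]
  have m3 : (-r) ^ 2 = 1 / 2 := by rw [neg_sq, hr2]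
  rw [hr2, m1] at wp sp
  rw [hr2, m2, m3] at wm sm
  have hbb : b ^ 2 ≠ 0 := pow_ne_zero 2 hb1
  have R1 : Kf e1 e2 = Kf e1 e3 := by
    have : b ^ 2 * (Kf e1 e2 - Kf e1 e3) = 0 := by linarith
    have := (mul_eq_zero.mp this).resolve_left hbb
    linarith
  rw [R1] at A1 A5 A7 A8
  have R2 : Kf e2 e3 = Kf e1 e3 := by
    have : b ^ 2 * (Kf e1 e3 - Kf e2 e3) = 0 := by
      have s1 : Kf e3 yp + Kf e3 ym = Kf e1 e3 + Kf e2 e3 := by linarith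
      have s2 : b ^ 2 * (Kf e3 yp + Kf e3 ym) = b ^ 2 * (Kf e1 e3 + Kf e2 e3) := by rw [s1]
      linarith
    have := (mul_eq_zero.mp this).resolve_left hbb
    linarith
  have R3 : Kf e3 yp = Kf e3 ym := by
    have : b ^ 2 * (Kf e3 yp - Kf e3 ym) = 0 := by linarith
    have := (mul_eq_zero.mp this).resolve_left hbb
    linarith
  refine ⟨R2, fun c s hcs => ?_⟩
  have A := h.hE e3 (c • e1 + s • e2) h33 (by rw [ipc]; linarith) (ip3' _ _)
  rw [hW, hS, hb3] at A
  have WS : W + S = 0 := by linarith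
  linear_combination A + c * s * WS - c ^ 2 * A3 - s ^ 2 * A4 + (Kf e1 e3 - Ξ e3) * hcs + s ^ 2 * R2

theorem exists_perp [FiniteDimensional ℝ V] (hd : 3 ≤ Module.finrank ℝ V)
    (h : PtData ip β Kf ω σ Ξ) (u v : V) :
    ∃ z, ip z z = 1 ∧ ip u z = 0 ∧ ip v z = 0 := by
  let f : V →ₗ[ℝ] (Fin 2 → ℝ) := LinearMap.pi ![ip u, ip v]
  have : LinearMap.ker f ≠ ⊥ := LinearMap.ker_ne_bot_of_finrank_lt (by simp; omega)
  obtain ⟨z, hz, hz0⟩ := Submodule.exists_mem_ne_zero_of_ne_bot this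
  have hz1 : ip u z = 0 := congrFun (LinearMap.mem_ker.mp hz) 0
  have hz2 : ip v z = 0 := congrFun (LinearMap.mem_ker.mp hz) 1
  have hp := h.pos z hz0
  have hs := Real.sq_sqrt hp.le
  have hs0 : Real.sqrt (ip z z) ≠ 0 := (Real.sqrt_pos.mpr hp).ne'
  refine ⟨(Real.sqrt (ip z z))⁻¹ • z, ?_, ?_, ?_⟩
  · simp only [map_smul, LinearMap.smul_apply, smul_eq_mul]
    field_simp
    exact hs.symm
  · simp [hz1]
  · simp [hz2]

theorem normalize (h : PtData ip β Kf ω σ Ξ) (z : V) (hz : z ≠ 0) :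
    ∃ r : ℝ, r ≠ 0 ∧ ip (r • z) (r • z) = 1 := by
  have hp := h.pos z hz
  have hs := Real.sq_sqrt hp.le
  have hs0 : Real.sqrt (ip z z) ≠ 0 := (Real.sqrt_pos.mpr hp).ne'
  refine ⟨(Real.sqrt (ip z z))⁻¹, inv_ne_zero hs0, ?_⟩
  simp only [map_smul, LinearMap.smul_apply, smul_eq_mul]
  field_simp
  exact hs.symm

/-- `e = c u + s w` with `w` a unit vector orthogonal to `u` and `t`. -/
theorem decomp [FiniteDimensional ℝ V] (hd : 3 ≤ Module.finrank ℝ V)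
    (h : PtData ip β Kf ω σ Ξ) (u t e : V) (hu : ip u u = 1) (he : ip e e = 1)
    (hut : ip u t = 0) (het : ip e t = 0) :
    ∃ (w : V) (c s : ℝ), ip w w = 1 ∧ ip u w = 0 ∧ ip w t = 0 ∧ c ^ 2 + s ^ 2 = 1 ∧
      e = c • u + s • w := by
  have key : ∃ (w : V) (c s : ℝ), ip w w = 1 ∧ ip u w = 0 ∧ ip w t = 0 ∧
      e = c • u + s • w := by
    by_cases hf : e - ip u e • u = 0
    · obtain ⟨z, hz, hz1, hz2⟩ := h.exists_perp hd u t
      refine ⟨z, ip u e, 0, hz, hz1, by rw [h.symm, hz2], ?_⟩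
      rw [zero_smul, add_zero]; exact sub_eq_zero.mp hf
    · obtain ⟨r, hr, hr1⟩ := h.normalize _ hf
      refine ⟨r • (e - ip u e • u), ip u e, r⁻¹, hr1, ?_, ?_, ?_⟩
      · simp [hu]
      · simp [hut, het]
      · rw [smul_smul, inv_mul_cancel₀ hr, one_smul]; abel
  obtain ⟨w, c, s, h1, h2, h3, h4⟩ := key
  refine ⟨w, c, s, h1, h2, h3, ?_, h4⟩
  have h5 : ip w u = 0 := by rw [h.symm, h2]
  rw [h4] at he
  simp [hu, h1, h2, h5] at he
  linarith

theorem isotropic [FiniteDimensional ℝ V] (hd : 3 ≤ Module.finrank ℝ V)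
    (h : PtData ip β Kf ω σ Ξ) (hβ : β ≠ 0) :
    ∃ c : ℝ, ∀ y v, LinearIndependent ℝ ![y, v] → Kf y v = c := by
  have hinj : Function.Injective ip := by
    rw [← LinearMap.ker_eq_bot, LinearMap.ker_eq_bot']
    intro m hm
    by_contra hne
    have := h.pos m hne
    rw [hm] at this
    simp at this
  have hsur : Function.Surjective ip :=
    (LinearMap.injective_iff_surjective_of_finrank_eq_finrank
      (Subspace.dual_finrank_eq (K := ℝ) (V := V)).symm).mp hinj
  obtain ⟨z, hz⟩ := hsur β
  have hz0 : z ≠ 0 := by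
    rintro rfl
    exact hβ (by rw [← hz, map_zero])
  obtain ⟨r, hr, h11⟩ := h.normalize z hz0
  set e1 := r • z with he1
  have hβv : ∀ v, β v = r⁻¹ * ip e1 v := by
    intro v
    rw [← hz, he1]
    simp [hr]
  have hb1 : β e1 ≠ 0 := by rw [hβv, h11, mul_one]; exact inv_ne_zero hr
  have hb0 : ∀ v, ip e1 v = 0 → β v = 0 := by
    intro v hv; rw [hβv, hv, mul_zero]
  have hb0' : ∀ v, β v = 0 → ip e1 v = 0 := by
    intro v hv
    rw [hβv] at hv
    exact (mul_eq_zero.mp hv).resolve_left (inv_ne_zero hr)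
  obtain ⟨e3, h33, h13, -⟩ := h.exists_perp hd e1 e1
  -- independence of the third vector
  have step1 : ∀ f, ip f f = 1 → ip e1 f = 0 → Kf e1 f = Kf e1 e3 := by
    intro f hf h1f
    obtain ⟨w, c, s, hw, h3w, hw1, hcs, hfe⟩ :=
      h.decomp hd e3 e1 f h33 hf (by rw [h.symm, h13]) (by rw [h.symm, h1f])
    have h1w : ip e1 w = 0 := by rw [h.symm, hw1]
    have hw3 : ip w e3 = 0 := by rw [h.symm, h3w]
    set g := (-s) • e3 + c • w with hg
    have T1 := (h.triple h11 hw h33 h1w h13 hw3 hb1 (hb0 _ h1w) (hb0 _ h13)).1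
    have hgg : ip g g = 1 := by
      simp [hg, h33, hw, h3w, hw3]; linarith
    have h1g : ip e1 g = 0 := by simp [hg, h13, h1w]
    have hgf : ip g f = 0 := by
      rw [hfe]; simp [hg, h33, hw, h3w, hw3]; ring
    have T2 := (h.triple h11 hgg hf h1g h1f hgf hb1 (hb0 _ h1g) (hb0 _ h1f)).1
    have T3 : Kf g f = Kf w e3 := by
      rw [hfe, hg]
      rw [← h.Ksymm (h.li hw h33 hw3)]
      exact h.hK e3 w (-s) c c s (h.li h33 hw h3w) (by nlinarith)
    rw [← T2, T3, T1]
  refine ⟨Kf e1 e3, fun y v hl => ?_⟩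
  have hl' := LinearIndependent.pair_iff.mp hl
  -- unit vector in the plane and the kernel
  obtain ⟨p, q, hpq, hker⟩ : ∃ p q : ℝ, (p ≠ 0 ∨ q ≠ 0) ∧ β (p • y + q • v) = 0 := by
    by_cases hy : β y = 0
    · exact ⟨1, 0, Or.inl one_ne_zero, by simp [hy]⟩
    · exact ⟨β v, - β y, Or.inr (neg_ne_zero.mpr hy), by simp; ring⟩
  have hne : p • y + q • v ≠ 0 := by
    intro h0
    obtain ⟨h1, h2⟩ := hl' p q h0
    rcases hpq with h3 | h3
    · exact h3 h1
    · exact h3 h2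
  obtain ⟨r1, hr1, hff⟩ := h.normalize _ hne
  set f := r1 • (p • y + q • v) with hf
  have hβf : β f = 0 := by rw [hf, map_smul, hker, smul_zero]
  have h1f := hb0' _ hβf
  -- complement in the plane
  obtain ⟨p', q', hdet⟩ : ∃ p' q' : ℝ, p * q' - q * p' ≠ 0 := by
    rcases hpq with h3 | h3
    · exact ⟨0, 1, by simpa using h3⟩
    · exact ⟨1, 0, by simpa using h3⟩
  set k := ip f (p' • y + q' • v) with hk
  have hne2 : (p' - k * r1 * p) • y + (q' - k * r1 * q) • v ≠ 0 := by
    intro h0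
    obtain ⟨h1, h2⟩ := hl' _ _ h0
    apply hdet
    linear_combination p * h2 - q * h1
  obtain ⟨r2, hr2, hee⟩ := h.normalize _ hne2
  set e := r2 • ((p' - k * r1 * p) • y + (q' - k * r1 * q) • v) with he
  have hfe : ip f e = 0 := by
    have : (p' - k * r1 * p) • y + (q' - k * r1 * q) • v = (p' • y + q' • v) - k • f := by
      rw [hf]; module
    rw [he, this, (ip f).map_smul, (ip f).map_sub, (ip f).map_smul, hff, ← hk]; simp
  have hKfe : Kf f e = Kf y v := by
    have e1' : f = (r1 * p) • y + (r1 * q) • v := by rw [hf]; module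
    have e2' : e = (r2 * (p' - k * r1 * p)) • y + (r2 * (q' - k * r1 * q)) • v := by
      rw [he]; module
    rw [e1', e2']
    apply h.hK _ _ _ _ _ _ hl
    have : r1 * p * (r2 * (q' - k * r1 * q)) - r1 * q * (r2 * (p' - k * r1 * p))
        = r1 * r2 * (p * q' - q * p') := by ring
    rw [this]
    exact mul_ne_zero (mul_ne_zero hr1 hr2) hdet
  obtain ⟨w, c, s, hw, h1w, hwf, hcs, hec⟩ :=
    h.decomp hd e1 f e h11 hee h1f (by rw [h.symm, hfe])
  have T := (h.triple h11 hw hff h1w h1f hwf hb1 (hb0 _ h1w) hβf).2 c s hcs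
  rw [← hec, hKfe, step1 f hff h1f] at T
  exact T

end PtData
end LinAlg

section Conc
open scoped ContDiff

section Gen
variable {P : Type*} [NormedAddCommGroup P] [NormedSpace ℝ P]

/-- extension by zero. -/
def ex {S : Set P} (f : S → ℝ) : P → ℝ := fun p => by
  classical exact if h : p ∈ S then f ⟨p, h⟩ else 0

theorem ex_of {S : Set P} (f : S → ℝ) {p : P} (h : p ∈ S) : ex f p = f ⟨p, h⟩ := by
  simp [ex, h]

/-- algebra of smooth functions on `S`. -/
def Sm (S : Set P) : Subalgebra ℝ (S → ℝ) where
  carrier := {f | ContDiffOn ℝ ∞ (ex f) S}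
  mul_mem' := by
    intro f g hf hg
    exact (ContDiffOn.mul hf hg).congr fun p hp => by simp [ex_of _ hp]
  add_mem' := by
    intro f g hf hg
    exact (ContDiffOn.add hf hg).congr fun p hp => by simp [ex_of _ hp]
  algebraMap_mem' := by
    intro r
    exact (contDiffOn_const (c := r)).congr fun p hp => by simp [ex_of _ hp]

theorem Sm_smooth {S : Set P} (φ : Sm S) : ContDiffOn ℝ ∞ (ex φ.1) S := φ.2

/-- smooth function as an element. -/
def mkS {S : Set P} (g : P → ℝ) (hg : ContDiffOn ℝ ∞ g S) : Sm S :=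
  ⟨fun p => g p, hg.congr fun p hp => by simp [ex_of _ hp]⟩

theorem Sm_diff {S : Set P} (hS : IsOpen S) (φ : Sm S) {p : P} (hp : p ∈ S) :
    DifferentiableAt ℝ (ex φ.1) p :=
  ((Sm_smooth φ).contDiffAt (hS.mem_nhds hp)).differentiableAt (by simp)

theorem fderiv_smooth {S : Set P} (hS : IsOpen S) {g : P → ℝ} (hg : ContDiffOn ℝ ∞ g S) (v : P) :
    ContDiffOn ℝ ∞ (fun p => fderiv ℝ g p v) S :=
  (hg.fderiv_of_isOpen hS (m := ∞) (by simp)).clm_apply contDiffOn_const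

theorem fd_congr {S : Set P} (hS : IsOpen S) {f g : P → ℝ} (h : ∀ p ∈ S, f p = g p) {p : P}
    (hp : p ∈ S) : fderiv ℝ f p = fderiv ℝ g p :=
  Filter.EventuallyEq.fderiv_eq (Filter.eventuallyEq_of_mem (hS.mem_nhds hp) h)

/-- directional derivative. -/
def dd {S : Set P} (hS : IsOpen S) (v : P) : Derivation ℝ (Sm S) (Sm S) :=
  Derivation.mk'
    { toFun := fun φ => mkS (fun p => fderiv ℝ (ex φ.1) p v) (fderiv_smooth hS φ.2 v)
      map_add' := by
        intro φ ψ
        ext ⟨p, hp⟩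
        change fderiv ℝ (ex (φ + ψ).1) p v = fderiv ℝ (ex φ.1) p v + fderiv ℝ (ex ψ.1) p v
        rw [fd_congr hS (g := fun p => ex φ.1 p + ex ψ.1 p) (fun p hp => by simp [ex_of _ hp]) hp,
          fderiv_fun_add (Sm_diff hS φ hp) (Sm_diff hS ψ hp)]
        rfl
      map_smul' := by
        intro c φ
        ext ⟨p, hp⟩
        change fderiv ℝ (ex (c • φ).1) p v = c * fderiv ℝ (ex φ.1) p v
        rw [fd_congr hS (g := fun p => c * ex φ.1 p) (fun p hp => by simp [ex_of _ hp]) hp,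
          fderiv_const_mul (Sm_diff hS φ hp)]
        rfl }
    (by
      intro φ ψ
      ext ⟨p, hp⟩
      change fderiv ℝ (ex (φ * ψ).1) p v = φ.1 ⟨p, hp⟩ * fderiv ℝ (ex ψ.1) p v
        + ψ.1 ⟨p, hp⟩ * fderiv ℝ (ex φ.1) p v
      rw [fd_congr hS (g := fun p => ex φ.1 p * ex ψ.1 p) (fun p hp => by simp [ex_of _ hp]) hp,
        fderiv_fun_mul (Sm_diff hS φ hp) (Sm_diff hS ψ hp), ex_of _ hp, ex_of _ hp]
      rfl)

theorem dd_apply {S : Set P} (hS : IsOpen S) (v : P) (φ : Sm S) {p : P} (hp : p ∈ S) :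
    (dd hS v φ).1 ⟨p, hp⟩ = fderiv ℝ (ex φ.1) p v := rfl

theorem dd_rep {S : Set P} (hS : IsOpen S) (v : P) (φ : Sm S) (g : P → ℝ)
    (hg : ∀ p (hp : p ∈ S), g p = φ.1 ⟨p, hp⟩) {p : P} (hp : p ∈ S) :
    (dd hS v φ).1 ⟨p, hp⟩ = fderiv ℝ g p v := by
  rw [dd_apply, fd_congr hS (g := g) (fun p hp => by rw [ex_of _ hp, hg p hp]) hp]

theorem dd_comm {S : Set P} (hS : IsOpen S) (u v : P) (φ : Sm S) :
    dd hS u (dd hS v φ) = dd hS v (dd hS u φ) := by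
  ext ⟨p, hp⟩
  rw [dd_rep hS u (dd hS v φ) (fun p => fderiv ℝ (ex φ.1) p v) (fun _ _ => rfl) hp,
    dd_rep hS v (dd hS u φ) (fun p => fderiv ℝ (ex φ.1) p u) (fun _ _ => rfl) hp]
  have hc : ContDiffAt ℝ ∞ (ex φ.1) p := (Sm_smooth φ).contDiffAt (hS.mem_nhds hp)
  have hd : DifferentiableAt ℝ (fderiv ℝ (ex φ.1)) p :=
    (hc.fderiv_right (m := ∞) (by simp)).differentiableAt (by simp)
  have e : ∀ v u, fderiv ℝ (fun p => fderiv ℝ (ex φ.1) p v) p u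
      = fderiv ℝ (fderiv ℝ (ex φ.1)) p u v := by
    intro v u
    rw [fderiv_clm_apply hd (differentiableAt_const v)]
    simp
  rw [e, e]
  have hs : IsSymmSndFDerivAt ℝ (ex φ.1) p := hc.isSymmSndFDerivAt (by simp; exact WithTop.coe_le_coe.mpr le_top)
  exact hs u v

/-- evaluation. -/
def ev {S : Set P} (w : S) : Sm S →ₐ[ℝ] ℝ := (Pi.evalAlgHom ℝ (fun _ : S => ℝ) w).comp (Sm S).val

theorem ev_apply {S : Set P} (w : S) (φ : Sm S) : ev w φ = φ.1 w := rfl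

theorem Sm_ext {S : Set P} {φ ψ : Sm S} (h : ∀ w, ev w φ = ev w ψ) : φ = ψ :=
  Subtype.ext (funext h)

theorem Sm_inv {S : Set P} (φ : Sm S) (h : ∀ w, ev w φ ≠ 0) : ∃ ψ, φ * ψ = 1 := by
  refine ⟨mkS (fun p => (ex φ.1 p)⁻¹) (ContDiffOn.inv φ.2 fun p hp => ?_), ?_⟩
  · rw [ex_of _ hp]; exact h ⟨p, hp⟩
  · apply Sm_ext
    rintro ⟨p, hp⟩
    change φ.1 ⟨p, hp⟩ * (ex φ.1 p)⁻¹ = 1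
    rw [ex_of _ hp]
    exact mul_inv_cancel₀ (h ⟨p, hp⟩)

end Gen

variable {n : ℕ}

/-- domain. -/
def WW (U : Set (E n)) : Set (E n × E n) := U ×ˢ {y : E n | y ≠ 0}

theorem WW_open {U : Set (E n)} (hU : IsOpen U) : IsOpen (WW U) :=
  hU.prod isOpen_ne

theorem mem_WW {U : Set (E n)} {x y : E n} : (x, y) ∈ WW U ↔ x ∈ U ∧ y ≠ 0 := Iff.rfl

/-- base derivation. -/
def XX {U : Set (E n)} (hU : IsOpen U) (k : Fin n) : Derivation ℝ (Sm (WW U)) (Sm (WW U)) :=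
  dd (WW_open hU) (e n k, 0)
/-- fiber derivation. -/
def YY {U : Set (E n)} (hU : IsOpen U) (k : Fin n) : Derivation ℝ (Sm (WW U)) (Sm (WW U)) :=
  dd (WW_open hU) (0, e n k)

/-- `f` is represented by `φ`. -/
def Rep {U : Set (E n)} (f : E n → E n → ℝ) (φ : Sm (WW U)) : Prop :=
  ∀ x y (h : (x, y) ∈ WW U), f x y = ev ⟨(x, y), h⟩ φ

theorem Rep.uncurry {U : Set (E n)} {f : E n → E n → ℝ} {φ : Sm (WW U)} (h : Rep f φ) :
    ∀ p (hp : p ∈ WW U), (fun p : E n × E n => f p.1 p.2) p = φ.1 ⟨p, hp⟩ :=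
  fun p hp => h p.1 p.2 hp

theorem Rep.diff {U : Set (E n)} (hU : IsOpen U) {f : E n → E n → ℝ} {φ : Sm (WW U)} (h : Rep f φ)
    {p : E n × E n} (hp : p ∈ WW U) : DifferentiableAt ℝ (fun p : E n × E n => f p.1 p.2) p :=
  (Sm_diff (WW_open hU) φ hp).congr_of_eventuallyEq
    (Filter.eventuallyEq_of_mem ((WW_open hU).mem_nhds hp)
      (fun q hq => by rw [ex_of _ hq]; exact h.uncurry q hq))

theorem Rep.pdy {U : Set (E n)} (hU : IsOpen U) {f : E n → E n → ℝ} {φ : Sm (WW U)} (h : Rep f φ)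
    (i : Fin n) : Rep (pdy n f i) (YY hU i φ) := by
  intro x y hp
  rw [ev_apply, YY, dd_rep (WW_open hU) _ φ _ h.uncurry hp, Paper.pdy]
  have h1 := (h.diff hU hp).hasFDerivAt
  have h2 := HasFDerivAt.comp y h1 (hasFDerivAt_prodMk_right x y)
  have h3 : (fun p : E n × E n => f p.1 p.2) ∘ (fun y => (x, y)) = f x := rfl
  rw [h3] at h2
  rw [h2.fderiv]
  simp

theorem Rep.pdx {U : Set (E n)} (hU : IsOpen U) {f : E n → E n → ℝ} {φ : Sm (WW U)} (h : Rep f φ)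
    (i : Fin n) : Rep (pdx n f i) (XX hU i φ) := by
  intro x y hp
  rw [ev_apply, XX, dd_rep (WW_open hU) _ φ _ h.uncurry hp, Paper.pdx]
  have h1 := (h.diff hU hp).hasFDerivAt
  have h2 := HasFDerivAt.comp x h1 (hasFDerivAt_prodMk_left (𝕜 := ℝ) x y)
  have h3 : (fun p : E n × E n => f p.1 p.2) ∘ (fun x => (x, y)) = fun x => f x y := rfl
  rw [h3] at h2
  rw [h2.fderiv]
  simp

/-- fiber coordinate. -/
def yc (U : Set (E n)) (k : Fin n) : Sm (WW U) :=
  mkS (fun p => p.2 k) (by fun_prop)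

/-- function of the base point only. -/
def bs {U : Set (E n)} (f : E n → ℝ) (hf : ContDiffOn ℝ ∞ f U) : Sm (WW U) :=
  mkS (fun p => f p.1) (hf.comp contDiffOn_fst fun _ hp => hp.1)

theorem rep_yc (U : Set (E n)) (k : Fin n) : Rep (fun _ y => y k) (yc U k) := fun _ _ _ => rfl

theorem rep_bs {U : Set (E n)} (f : E n → ℝ) (hf : ContDiffOn ℝ ∞ f U) :
    Rep (fun x _ => f x) (bs f hf) := fun _ _ _ => rfl

theorem Rep.eqs {U : Set (E n)} {f : E n → E n → ℝ} {φ ψ : Sm (WW U)} (h : Rep f φ)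
    (h' : Rep f ψ) : φ = ψ :=
  Sm_ext fun w => by rw [← h w.1.1 w.1.2 w.2, ← h' w.1.1 w.1.2 w.2]

theorem YY_of_base {U : Set (E n)} (hU : IsOpen U) {φ : Sm (WW U)}
    (h : ∀ x y y' (h : (x, y) ∈ WW U) (h' : (x, y') ∈ WW U), ev ⟨(x, y), h⟩ φ = ev ⟨(x, y'), h'⟩ φ)
    (k : Fin n) : YY hU k φ = 0 := by
  apply Sm_ext
  rintro ⟨⟨x, y⟩, hp⟩
  have hr : Rep (fun x _ => ex φ.1 (x, y)) φ := by
    intro x' y' hp'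
    have : (x', y) ∈ WW U := ⟨hp'.1, hp.2⟩
    refine (ex_of φ.1 this).trans ?_
    exact h x' y y' this hp'
  rw [← hr.pdy hU k x y hp, Paper.pdy, map_zero]
  simp

theorem frame {U : Set (E n)} (hU : IsOpen U) : Frame (XX hU) (YY hU) (yc U) where
  XX := fun _ _ _ => dd_comm _ _ _ _
  XY := fun _ _ _ => dd_comm _ _ _ _
  YY := fun _ _ _ => dd_comm _ _ _ _
  Yy := by
    intro i j
    apply Sm_ext
    rintro ⟨⟨x, y⟩, hp⟩
    rw [← (rep_yc U j).pdy hU i x y hp, Paper.pdy]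
    have : fderiv ℝ (fun y : E n => y j) y = ContinuousLinearMap.proj j :=
      (ContinuousLinearMap.proj (R := ℝ) (φ := fun _ : Fin n => ℝ) j).fderiv
    rw [this]
    by_cases hij : i = j
    · subst hij; simp [e]
    · have : j ≠ i := fun h => hij h.symm
      simp [e, hij, this]
  Xy := by
    intro i j
    apply Sm_ext
    rintro ⟨⟨x, y⟩, hp⟩
    rw [← (rep_yc U j).pdx hU i x y hp, Paper.pdx, map_zero]
    simp

/-- reflection. -/
theorem WW_neg {U : Set (E n)} {p : E n × E n} (hp : p ∈ WW U) : (p.1, - p.2) ∈ WW U :=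
  ⟨hp.1, neg_ne_zero.mpr hp.2⟩

/-- reflection of the fiber. -/
def sg (U : Set (E n)) : Sm (WW U) →ₐ[ℝ] Sm (WW U) where
  toFun φ := ⟨fun w => φ.1 ⟨(w.1.1, - w.1.2), WW_neg w.2⟩, by
    have h1 : ContDiffOn ℝ ∞ (fun p : E n × E n => (p.1, - p.2)) (WW U) := by fun_prop
    exact ((Sm_smooth φ).comp h1 (fun p hp => WW_neg hp)).congr fun p hp => by
      rw [ex_of _ hp]; exact (ex_of _ (WW_neg hp)).symm⟩
  map_one' := rfl
  map_mul' _ _ := rfl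
  map_zero' := rfl
  map_add' _ _ := rfl
  commutes' _ := rfl

theorem ev_sg {U : Set (E n)} {x y : E n} (h : (x, y) ∈ WW U) (φ : Sm (WW U)) :
    ev ⟨(x, y), h⟩ (sg U φ) = ev ⟨(x, -y), WW_neg h⟩ φ := rfl

theorem sg_rep {U : Set (E n)} (φ : Sm (WW U)) :
    Rep (fun x y => ex φ.1 (x, -y)) (sg U φ) := by
  intro x y h
  rw [ev_sg]; exact ex_of _ (WW_neg h)

theorem self_rep {U : Set (E n)} (φ : Sm (WW U)) :
    Rep (fun x y => ex φ.1 (x, y)) φ := by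
  intro x y h
  exact ex_of _ h

theorem sg_X {U : Set (E n)} (hU : IsOpen U) (k : Fin n) (φ : Sm (WW U)) :
    sg U (XX hU k φ) = XX hU k (sg U φ) := by
  apply Sm_ext
  rintro ⟨⟨x, y⟩, hp⟩
  rw [← (sg_rep φ).pdx hU k x y hp, ev_sg, ← (self_rep φ).pdx hU k x (-y) (WW_neg hp)]
  rfl

theorem sg_Y {U : Set (E n)} (hU : IsOpen U) (k : Fin n) (φ : Sm (WW U)) :
    sg U (YY hU k φ) = - YY hU k (sg U φ) := by
  apply Sm_ext
  rintro ⟨⟨x, y⟩, hp⟩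
  rw [map_neg, ← (sg_rep φ).pdy hU k x y hp, ev_sg, ← (self_rep φ).pdy hU k x (-y) (WW_neg hp)]
  unfold Paper.pdy
  have h1 := ((self_rep φ).diff hU (WW_neg hp)).hasFDerivAt
  have h2 := HasFDerivAt.comp (-y) h1 (hasFDerivAt_prodMk_right x (-y))
  have h3 := HasFDerivAt.comp y h2 (hasFDerivAt_id y).neg
  have e1 : fderiv ℝ ((fun x y => ex φ.1 (x, y)) x) (-y) = _ := h2.fderiv
  have e2 : fderiv ℝ ((fun x y => ex φ.1 (x, -y)) x) y = _ := h3.fderiv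
  rw [e1, e2]
  simp

theorem sg_y (U : Set (E n)) (k : Fin n) : sg U (yc U k) = - yc U k := rfl
theorem sg_bs {U : Set (E n)} (f : E n → ℝ) (hf : ContDiffOn ℝ ∞ f U) :
    sg U (bs f hf) = bs f hf := rfl

/-- vanishing fiber derivatives. -/
theorem base_of_YY {U : Set (E n)} (hU : IsOpen U) (hn : 2 ≤ n) {φ : Sm (WW U)}
    (h : ∀ k, YY hU k φ = 0) {x y y' : E n} (hy : (x, y) ∈ WW U) (hy' : (x, y') ∈ WW U) :
    ev ⟨(x, y), hy⟩ φ = ev ⟨(x, y'), hy'⟩ φ := by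
  have hconn : IsPreconnected ({0}ᶜ : Set (E n)) :=
    (isConnected_compl_singleton_of_one_lt_rank (by
      rw [rank_fun', Fintype.card_fin]; exact_mod_cast hn) 0).isPreconnected
  have hd : DifferentiableOn ℝ (fun y => ex φ.1 (x, y)) ({0}ᶜ : Set (E n)) := by
    intro z hz
    have := (Sm_diff (WW_open hU) φ (p := (x, z)) ⟨hy.1, hz⟩)
    exact (DifferentiableAt.comp z this (by fun_prop)).differentiableWithinAt
  have h0 : ({0}ᶜ : Set (E n)).EqOn (fderiv ℝ (fun y => ex φ.1 (x, y))) 0 := by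
    intro z hz
    have hz' : (x, z) ∈ WW U := ⟨hy.1, hz⟩
    have : ∀ k, fderiv ℝ (fun y => ex φ.1 (x, y)) z (e n k) = 0 := by
      intro k
      have := (self_rep φ).pdy hU k x z hz'
      rw [h k, map_zero] at this
      exact this
    ext v
    have hv : v = ∑ k, v k • e n k := by
      ext j; simp [e, Finset.sum_apply, Pi.single_apply]
    rw [hv, map_sum]
    simp [this]
  have := IsOpen.is_const_of_fderiv_eq_zero (isOpen_compl_singleton) hconn hd h0 hy.2 hy'.2
  rw [← (self_rep φ) x y hy, ← (self_rep φ) x y' hy']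
  exact this

end Conc

section Setup
open scoped ContDiff
variable {n : ℕ}

/-- concrete Randers data in the algebra of smooth functions. -/
structure CS {U : Set (E n)} (hU : IsOpen U) (a : E n → Matrix (Fin n) (Fin n) ℝ) (b : E n → E n)
    (F : E n → E n → ℝ) (aA aiA : Fin n → Fin n → Sm (WW U)) (bA : Fin n → Sm (WW U))
    (alA ali Fi : Sm (WW U)) : Prop where
  rd : RData (XX hU) (YY hU) (yc U) aA aiA bA alA ali Fi
  fin : IsFinsler n U F
  evA : ∀ x y (h : (x, y) ∈ WW U) i j, ev ⟨(x, y), h⟩ (aA i j) = a x i j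
  evB : ∀ x y (h : (x, y) ∈ WW U) i, ev ⟨(x, y), h⟩ (bA i) = b x i
  alpos : ∀ w, 0 < ev w alA
  repF : Rep F (alA + ∑ i, bA i * yc U i)
  apos : ∀ x ∈ U, (a x).PosDef
  sgai : ∀ i j, sg U (aiA i j) = aiA i j
  sgb : ∀ i, sg U (bA i) = bA i
  sgal : sg U alA = alA

theorem exists_CS (U : Set (E n)) (hU : IsOpen U)
    (a : E n → Matrix (Fin n) (Fin n) ℝ) (b : E n → E n)
    (ha_smooth : ∀ i j : Fin n, ContDiffOn ℝ (⊤ : ℕ∞) (fun x => a x i j) U)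
    (hb_smooth : ∀ i : Fin n, ContDiffOn ℝ (⊤ : ℕ∞) (fun x => b x i) U)
    (ha_symm : ∀ x ∈ U, (a x).IsSymm)
    (ha_posdef : ∀ x ∈ U, (a x).PosDef)
    (F : E n → E n → ℝ)
    (hF_eq : ∀ x ∈ U, ∀ y : E n,
      F x y = Real.sqrt (∑ i, ∑ j, a x i j * y i * y j) + ∑ i, b x i * y i)
    (hF : IsFinsler n U F) :
    ∃ aA aiA bA alA ali Fi, CS hU a b F aA aiA bA alA ali Fi := by
  set aA : Fin n → Fin n → Sm (WW U) := fun i j => bs _ (ha_smooth i j) with haA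
  set bA : Fin n → Sm (WW U) := fun i => bs _ (hb_smooth i) with hbA
  have evA : ∀ x y (h : (x, y) ∈ WW U) i j, ev ⟨(x, y), h⟩ (aA i j) = a x i j :=
    fun _ _ _ _ _ => rfl
  have evB : ∀ x y (h : (x, y) ∈ WW U) i, ev ⟨(x, y), h⟩ (bA i) = b x i := fun _ _ _ _ => rfl
  -- the norm
  have qpos : ∀ p ∈ WW U, 0 < ∑ i, ∑ j, a p.1 i j * p.2 i * p.2 j := by
    intro p hp
    have := (ha_posdef p.1 hp.1).dotProduct_mulVec_pos hp.2
    refine lt_of_lt_of_eq this ?_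
    simp only [dotProduct, Matrix.mulVec, Finset.mul_sum, Pi.star_apply, star_trivial]
    exact Finset.sum_congr rfl fun _ _ => Finset.sum_congr rfl fun _ _ => by ring
  have haf : ∀ i j, ContDiffOn ℝ ∞ (fun p : E n × E n => a p.1 i j) (WW U) :=
    fun i j => (ha_smooth i j).comp contDiffOn_fst fun _ hp => hp.1
  have hal : ContDiffOn ℝ ∞ (fun p : E n × E n => Real.sqrt (∑ i, ∑ j, a p.1 i j * p.2 i * p.2 j))
      (WW U) := by
    apply ContDiffOn.sqrt
    · apply ContDiffOn.sum; intro i _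
      apply ContDiffOn.sum; intro j _
      exact ((haf i j).mul (by fun_prop)).mul (by fun_prop)
    · intro p hp; exact (qpos p hp).ne'
  set alA : Sm (WW U) := mkS _ hal with halA
  have alpos : ∀ w, 0 < ev w alA := fun w => Real.sqrt_pos.mpr (qpos w.1 w.2)
  obtain ⟨ali, hali⟩ := Sm_inv alA (fun w => (alpos w).ne')
  have repF : Rep F (alA + ∑ i, bA i * yc U i) := by
    intro x y h
    rw [hF_eq x h.1 y, map_add, map_sum]
    rfl
  obtain ⟨Fi, hFi⟩ := Sm_inv (alA + ∑ i, bA i * yc U i) (fun w => by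
    rw [← repF w.1.1 w.1.2 w.2]; exact (hF.pos _ w.2.1 _ w.2.2).ne')
  set M : Matrix (Fin n) (Fin n) (Sm (WW U)) := Matrix.of aA with hM
  have hdet : IsUnit M.det := by
    obtain ⟨d, hd⟩ := Sm_inv M.det (fun w => by
      have : ev w M.det = (a w.1.1).det := by
        have := RingHom.map_det (ev w).toRingHom M
        rw [AlgHom.toRingHom_eq_coe, RingHom.coe_coe] at this
        rw [this]; rfl
      rw [this]
      exact (ha_posdef _ w.2.1).det_pos.ne')
    exact IsUnit.of_mul_eq_one d hd
  have hMM : M * M⁻¹ = 1 := Matrix.mul_nonsing_inv M hdet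
  have evai : ∀ x y (h : (x, y) ∈ WW U) i j, ev ⟨(x, y), h⟩ (M⁻¹ i j) = (a x)⁻¹ i j := by
    intro x y h i j
    have h1 : (a x) * (M⁻¹).map (ev ⟨(x, y), h⟩) = 1 := by
      have : a x = M.map (ev ⟨(x, y), h⟩) := rfl
      rw [this, ← Matrix.map_mul, hMM, Matrix.map_one _ (map_zero _) (map_one _)]
    rw [Matrix.inv_eq_right_inv h1]
    rfl
  refine ⟨aA, fun i j => M⁻¹ i j, bA, alA, ali, Fi, ⟨⟨frame hU, ?_, ?_, ?_, ?_, ?_, ?_, hali, hFi⟩, hF,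
    evA, evB, alpos, repF, ha_posdef, ?_, fun i => sg_bs _ _, ?_⟩⟩
  · intro i j
    apply Sm_ext
    rintro ⟨⟨x, y⟩, h⟩
    rw [evA, evA]
    exact ((ha_symm x h.1).apply i j).symm
  · intro k i j
    exact YY_of_base hU (fun x y y' h h' => by rw [evA, evA]) k
  · intro k i j
    exact YY_of_base hU (fun x y y' h h' => by rw [evai, evai]) k
  · intro k i
    exact YY_of_base hU (fun x y y' h h' => by rw [evB, evB]) k
  · intro i j
    have := congrFun (congrFun hMM i) j
    rw [Matrix.mul_apply, Matrix.one_apply] at this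
    exact this
  · apply Sm_ext
    rintro ⟨⟨x, y⟩, h⟩
    rw [map_mul, map_sum]
    simp only [map_sum, map_mul]
    exact Real.mul_self_sqrt (qpos _ h).le
  · intro i j
    apply Sm_ext
    rintro ⟨⟨x, y⟩, h⟩
    rw [ev_sg, evai, evai]
  · apply Sm_ext
    rintro ⟨⟨x, y⟩, h⟩
    rw [ev_sg]
    change Real.sqrt (∑ i, ∑ j, a x i j * (-y) i * (-y) j) = Real.sqrt _
    simp

namespace CS
variable {U : Set (E n)} {hU : IsOpen U} {a : E n → Matrix (Fin n) (Fin n) ℝ} {b : E n → E n}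
    {F : E n → E n → ℝ} {aA aiA : Fin n → Fin n → Sm (WW U)} {bA : Fin n → Sm (WW U)}
    {alA ali Fi : Sm (WW U)}

theorem ev_hf {U : Set (E n)} (w : WW U) : ev w (hf2 (Sm (WW U))) = 1 / 2 := by
  rw [hf2, AlgHom.commutes]; rfl

theorem repF2 (h : CS hU a b F aA aiA bA alA ali Fi) :
    Rep (F2 n F) ((alA + ∑ i, bA i * yc U i) * (alA + ∑ i, bA i * yc U i)) := by
  intro x y hp
  rw [map_mul, ← h.repF x y hp, F2, sq]

theorem repgm (h : CS hU a b F aA aiA bA alA ali Fi) (i j : Fin n) :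
    Rep (gm n F i j) (hf2 _ * YY hU i (YY hU j
      ((alA + ∑ i, bA i * yc U i) * (alA + ∑ i, bA i * yc U i)))) := by
  intro x y hp
  rw [map_mul, ev_hf, ← ((h.repF2.pdy hU j).pdy hU i) x y hp, gm]

theorem gm_symm (h : CS hU a b F aA aiA bA alA ali Fi) {x y : E n} (hp : (x, y) ∈ WW U)
    (i j : Fin n) : gm n F i j x y = gm n F j i x y := by
  rw [h.repgm i j x y hp, h.repgm j i x y hp, h.rd.fr.YY]

theorem g_inj (h : CS hU a b F aA aiA bA alA ali Fi) {x y : E n} (hp : (x, y) ∈ WW U)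
    (z : Fin n → ℝ) (hz : ∀ l, ∑ i, gm n F l i x y * z i = 0) : z = 0 := by
  by_contra hne
  have := (h.fin.posdef x hp.1 y hp.2).dotProduct_mulVec_pos hne
  have h0 : (gmat n F x y).mulVec z = 0 := by
    funext l
    exact hz l
  rw [h0] at this
  simp at this

theorem repSpray (h : CS hU a b F aA aiA bA alA ali Fi) (i : Fin n) :
    Rep (Spray n F i) (GR (XX hU) (YY hU) (yc U) aiA bA alA Fi i) := by
  intro x y hp
  set L := (alA + ∑ i, bA i * yc U i) * (alA + ∑ i, bA i * yc U i) with hL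
  have e1 : ∀ l, (∑ k, pdx n (pdy n (F2 n F) l) k x y * y k) - pdx n (F2 n F) l x y
      = 4 * ∑ k, gm n F l k x y * ev ⟨(x, y), hp⟩ (GR (XX hU) (YY hU) (yc U) aiA bA alA Fi k) := by
    intro l
    have hE := h.rd.ELR l
    rw [← hL] at hE
    have hr2 := h.repF2
    have hrg := h.repgm
    simp only [← hL] at hr2 hrg
    clear_value L
    have := congrArg (ev ⟨(x, y), hp⟩) hE
    rw [Sp_apply, map_sub, map_sum, map_mul, map_sum, map_ofNat] at this
    simp only [map_mul] at this
    have t1 : ∑ k, pdx n (pdy n (F2 n F) l) k x y * y k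
        = ∑ k, ev ⟨(x, y), hp⟩ (yc U k) * ev ⟨(x, y), hp⟩ (XX hU k (YY hU l L)) := by
      refine Finset.sum_congr rfl fun k _ => ?_
      rw [← ((hr2.pdy hU l).pdx hU k) x y hp, ← rep_yc U k x y hp, mul_comm]
    rw [t1, (hr2.pdx hU l) x y hp, ← this]
    have t2 : ∀ k, gm n F l k x y = 1 / 2 * ev ⟨(x, y), hp⟩ (YY hU k (YY hU l L)) := by
      intro k
      rw [h.gm_symm hp, hrg k l x y hp, map_mul, ev_hf]
    simp only [t2]
    rw [sub_sub_cancel, Finset.mul_sum, Finset.mul_sum]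
    exact Finset.sum_congr rfl fun k _ => by ring
  rw [Spray]
  simp only [e1]
  have hu : IsUnit (gmat n F x y).det := (h.fin.posdef x hp.1 y hp.2).det_pos.ne'.isUnit
  have hinv : ginv n F x y * gmat n F x y = 1 := Matrix.nonsing_inv_mul _ hu
  set G : Fin n → ℝ := fun k => ev ⟨(x, y), hp⟩ (GR (XX hU) (YY hU) (yc U) aiA bA alA Fi k) with hG
  have e2 : ∑ l, ginv n F x y i l * (4 * ∑ k, gm n F l k x y * G k)
      = 4 * ∑ k, (ginv n F x y * gmat n F x y) i k * G k := by
    simp only [Matrix.mul_apply, Finset.sum_mul, Finset.mul_sum]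
    rw [Finset.sum_comm]
    refine Finset.sum_congr rfl fun k _ => Finset.sum_congr rfl fun l _ => ?_
    rw [gmat, Matrix.of_apply]; ring
  rw [e2, hinv]
  simp [Matrix.one_apply, hG]

theorem repRiem (h : CS hU a b F aA aiA bA alA ali Fi) (i k : Fin n) :
    Rep (RiemUp n F i k) (Ru (XX hU) (YY hU) (yc U) (GR (XX hU) (YY hU) (yc U) aiA bA alA Fi) i k) := by
  intro x y hp
  rw [RiemUp, Ru]
  simp only [map_sub, map_add, map_sum, map_mul, map_ofNat]
  rw [((h.repSpray i).pdx hU k) x y hp]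
  simp only [((h.repSpray i).pdy hU _) x y hp, (((h.repSpray i).pdy hU k).pdx hU _) x y hp,
    (((h.repSpray i).pdy hU k).pdy hU _) x y hp, (h.repSpray _) x y hp,
    ((h.repSpray _).pdy hU k) x y hp]
  rfl

end CS
end Setup

section Alg7
variable {n : ℕ} {A : Type*} [CommRing A] [Algebra ℝ A]
variable {X Y : Fin n → Derivation ℝ A A} {y : Fin n → A}
variable {a ai : Fin n → Fin n → A} {b : Fin n → A} {al ali Fi : A}
namespace RData

theorem YYF (h : RData X Y y a ai b al ali Fi) (i j : Fin n) :
    Y i (Y j (al + ∑ i, b i * y i)) = Y i (Y j al) := by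
  rw [h.YF, map_add, h.Yb, add_zero]

theorem h_eq (h : RData X Y y a ai b al ali Fi) (i j : Fin n) :
    hf2 A * Y i (Y j ((al + ∑ i, b i * y i) * (al + ∑ i, b i * y i)))
      - Y i (al + ∑ i, b i * y i) * Y j (al + ∑ i, b i * y i)
      = (al + ∑ i, b i * y i) * Y i (Y j al) := by
  have := h.YYF i j
  set FA := al + ∑ i, b i * y i
  rw [D_mul, map_add, D_mul, D_mul, this]
  have h2 : 2 * hf2 A = 1 := two_hf
  linear_combination (FA * Y i (Y j al) + Y i FA * Y j FA) * h2

theorem uRF (h : RData X Y y a ai b al ali Fi) (k : Fin n) :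
    ∑ i, Ru X Y y (GR X Y y ai b al Fi) i k * Y i (al + ∑ i, b i * y i) = 0 := by
  have h1 := uRu h.fr _ h.EuGR _ h.EuFsq h.ELR k
  have hF := h.hFi
  set FA := al + ∑ i, b i * y i
  have h2 : 2 * (FA * ∑ i, Ru X Y y (GR X Y y ai b al Fi) i k * Y i FA) = 0 := by
    rw [← h1, Finset.mul_sum, Finset.mul_sum]
    exact Finset.sum_congr rfl fun i _ => by rw [D_mul]; ring
  have h3 : FA * ∑ i, Ru X Y y (GR X Y y ai b al Fi) i k * Y i FA = 0 := by
    apply cancel_two; rw [h2, mul_zero]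
  linear_combination Fi * h3 - (∑ i, Ru X Y y (GR X Y y ai b al Fi) i k * Y i FA) * hF

theorem Rlow_eq (h : RData X Y y a ai b al ali Fi) (j k : Fin n) :
    ∑ i, (hf2 A * Y i (Y j ((al + ∑ i, b i * y i) * (al + ∑ i, b i * y i))))
      * Ru X Y y (GR X Y y ai b al Fi) i k
    = (al + ∑ i, b i * y i) * ∑ i, Y i (Y j al) * Ru X Y y (GR X Y y ai b al Fi) i k := by
  have h1 := h.uRF k
  have h2 : ∀ i, (hf2 A * Y i (Y j ((al + ∑ i, b i * y i) * (al + ∑ i, b i * y i))))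
      * Ru X Y y (GR X Y y ai b al Fi) i k
      = (al + ∑ i, b i * y i) * (Y i (Y j al) * Ru X Y y (GR X Y y ai b al Fi) i k)
        + Y j (al + ∑ i, b i * y i) *
          (Ru X Y y (GR X Y y ai b al Fi) i k * Y i (al + ∑ i, b i * y i)) := by
    intro i
    linear_combination Ru X Y y (GR X Y y ai b al Fi) i k * h.h_eq i j
  simp only [h2]
  rw [Finset.sum_add_distrib, ← Finset.mul_sum, ← Finset.mul_sum, h1, mul_zero, add_zero]

theorem al_Rlow (h : RData X Y y a ai b al ali Fi) (j k : Fin n) :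
    al * ∑ i, (hf2 A * Y i (Y j ((al + ∑ i, b i * y i) * (al + ∑ i, b i * y i))))
      * Ru X Y y (GR X Y y ai b al Fi) i k
    = (al + ∑ i, b i * y i) * (∑ i, a j i * Ru X Y y (GR X Y y ai b al Fi) i k
      - Y j al * ∑ i, Y i al * Ru X Y y (GR X Y y ai b al Fi) i k) := by
  rw [h.Rlow_eq, mul_left_comm]
  congr 1
  rw [Finset.mul_sum, Finset.mul_sum, ← Finset.sum_sub_distrib]
  refine Finset.sum_congr rfl fun i _ => ?_
  linear_combination Ru X Y y (GR X Y y ai b al Fi) i k * h.alYY i j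

end RData
end Alg7

section Qforms
variable {n : ℕ}

/-- bilinear form with given coefficients. -/
def Qb (f : Fin n → Fin n → ℝ) : E n →ₗ[ℝ] E n →ₗ[ℝ] ℝ := Matrix.toBilin' (Matrix.of f)

theorem Qb_apply (f : Fin n → Fin n → ℝ) (u w : E n) : Qb f u w = ∑ i, ∑ j, u i * f i j * w j := by
  rw [Qb, Matrix.toBilin'_apply]; rfl

theorem Qb_anti (f : Fin n → Fin n → ℝ) (hf : ∀ i j, f i j = - f j i) (u w : E n) :
    Qb f u w = - Qb f w u := by
  rw [Qb_apply, Qb_apply, Finset.sum_comm, ← Finset.sum_neg_distrib]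
  refine Finset.sum_congr rfl fun j _ => ?_
  rw [← Finset.sum_neg_distrib]
  exact Finset.sum_congr rfl fun i _ => by rw [hf i j]; ring

theorem Qb_det (f : Fin n → Fin n → ℝ) (hf : ∀ i j, f i j = - f j i) (u w : E n) (p q r s : ℝ) :
    Qb f (p • u + q • w) (r • u + s • w) = (p * s - q * r) * Qb f u w := by
  have h1 : Qb f u u = 0 := by have := Qb_anti f hf u u; linarith
  have h2 : Qb f w w = 0 := by have := Qb_anti f hf w w; linarith
  have h3 := Qb_anti f hf w u
  simp only [map_add, map_smul, LinearMap.add_apply, LinearMap.smul_apply, smul_eq_mul, h1, h2, h3]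
  ring

theorem Qb_lin (f g : Fin n → Fin n → ℝ) (c s : ℝ) (u w : E n) :
    Qb (fun i j => c * f i j + s * g i j) u w = c * Qb f u w + s * Qb g u w := by
  simp only [Qb_apply, Finset.mul_sum, ← Finset.sum_add_distrib]
  exact Finset.sum_congr rfl fun _ _ => Finset.sum_congr rfl fun _ _ => by ring

theorem Qb_smulf (f : Fin n → Fin n → ℝ) (c : ℝ) (u w : E n) :
    Qb (fun i j => c * f i j) u w = c * Qb f u w := by
  simp only [Qb_apply, Finset.mul_sum]
  exact Finset.sum_congr rfl fun _ _ => Finset.sum_congr rfl fun _ _ => by ring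

/-- bilinear form of the Riemannian metric. -/
def Qa (a : E n → Matrix (Fin n) (Fin n) ℝ) (x : E n) : E n →ₗ[ℝ] E n →ₗ[ℝ] ℝ :=
  Qb (fun i j => a x i j)

theorem Qa_apply (a : E n → Matrix (Fin n) (Fin n) ℝ) (x u w : E n) :
    Qa a x u w = ∑ i, ∑ j, u i * a x i j * w j := Qb_apply _ _ _

/-- the symmetric part of the curvature. -/
def om (t : Fin n → Fin n → Fin n → Fin n → ℝ) (c : Fin n → Fin n → ℝ) (y p : E n) : ℝ :=
  Qb (fun m q => Qb (t m q) p y) p y + 3 / 4 * (Qb c y p) ^ 2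

theorem om_det (t : Fin n → Fin n → Fin n → Fin n → ℝ) (c : Fin n → Fin n → ℝ)
    (ht1 : ∀ m q k l, t m q k l = - t q m k l) (ht2 : ∀ m q k l, t m q k l = - t m q l k)
    (hc : ∀ i j, c i j = - c j i) (u w : E n) (p q r s : ℝ) :
    om t c (p • u + q • w) (r • u + s • w) = (p * s - q * r) ^ 2 * om t c u w := by
  have e1 : ∀ m l, Qb (t m l) (r • u + s • w) (p • u + q • w)
      = (p * s - q * r) * Qb (t m l) w u := by
    intro m l
    rw [Qb_det _ (ht2 m l), Qb_anti _ (ht2 m l) u w]; ring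
  have ha : ∀ m l, Qb (t m l) w u = - Qb (t l m) w u := by
    intro m l
    have : t m l = fun k i => (-1) * t l m k i := by
      funext k i; rw [ht1 m l k i]; ring
    rw [this, Qb_smulf]; ring
  rw [om, om]
  simp only [e1]
  rw [Qb_smulf, Qb_det _ ha, Qb_anti _ ha u w, Qb_det _ hc]
  ring

theorem om_symm (t : Fin n → Fin n → Fin n → Fin n → ℝ) (c : Fin n → Fin n → ℝ)
    (ht1 : ∀ m q k l, t m q k l = - t q m k l) (ht2 : ∀ m q k l, t m q k l = - t m q l k)
    (hc : ∀ i j, c i j = - c j i) (u w : E n) : om t c u w = om t c w u := by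
  have := om_det t c ht1 ht2 hc w u 0 1 1 0
  simpa using this

theorem om_quad (t : Fin n → Fin n → Fin n → Fin n → ℝ) (c : Fin n → Fin n → ℝ) (y u v : E n) :
    ∃ W : ℝ, ∀ r s : ℝ, om t c y (r • u + s • v)
      = r ^ 2 * om t c y u + s ^ 2 * om t c y v + r * s * W := by
  refine ⟨Qb (fun m q => Qb (t m q) u y) v y + Qb (fun m q => Qb (t m q) v y) u y
    + 3 / 2 * (Qb c y u * Qb c y v), fun r s => ?_⟩
  have e1 : ∀ m q, Qb (t m q) (r • u + s • v) y = r * Qb (t m q) u y + s * Qb (t m q) v y := by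
    intro m q
    simp
  rw [om, om, om]
  simp only [e1]
  rw [Qb_lin]
  simp only [map_add, map_smul, LinearMap.add_apply, LinearMap.smul_apply, smul_eq_mul]
  ring

theorem Qb_quad (f : Fin n → Fin n → ℝ) (u v : E n) :
    ∃ W : ℝ, ∀ r s : ℝ, Qb f (r • u + s • v) (r • u + s • v)
      = r ^ 2 * Qb f u u + s ^ 2 * Qb f v v + r * s * W := by
  refine ⟨Qb f u v + Qb f v u, fun r s => ?_⟩
  simp only [map_add, map_smul, LinearMap.add_apply, LinearMap.smul_apply, smul_eq_mul]
  ring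

end Qforms

section Pt
variable {n : ℕ}
namespace CS
variable {U : Set (E n)} {hU : IsOpen U} {a : E n → Matrix (Fin n) (Fin n) ℝ} {b : E n → E n}
    {F : E n → E n → ℝ} {aA aiA : Fin n → Fin n → Sm (WW U)} {bA : Fin n → Sm (WW U)}
    {alA ali Fi : Sm (WW U)}

theorem rephm (h : CS hU a b F aA aiA bA alA ali Fi) (i j : Fin n) :
    Rep (hm n F i j) ((alA + ∑ i, bA i * yc U i) * YY hU i (YY hU j alA)) := by
  intro x y hp
  rw [← h.rd.h_eq, map_sub, map_mul _ (YY hU i _) _, ← h.repgm i j x y hp, hm, Fy, Fy,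
    (h.repF.pdy hU i) x y hp, (h.repF.pdy hU j) x y hp]

theorem repRlow (h : CS hU a b F aA aiA bA alA ali Fi) (j k : Fin n) :
    Rep (Rlow n F j k) (∑ i, (hf2 _ * YY hU i (YY hU j
      ((alA + ∑ i, bA i * yc U i) * (alA + ∑ i, bA i * yc U i))))
      * Ru (XX hU) (YY hU) (yc U) (GR (XX hU) (YY hU) (yc U) aiA bA alA Fi) i k) := by
  intro x y hp
  rw [Rlow, map_sum]
  refine Finset.sum_congr rfl fun i _ => ?_
  rw [map_mul, ← h.repgm i j x y hp, ← h.repRiem i k x y hp]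

theorem ev_al_Y (h : CS hU a b F aA aiA bA alA ali Fi) {x y : E n} (hp : (x, y) ∈ WW U) (v : E n) :
    ev ⟨(x, y), hp⟩ alA * ∑ k, ev ⟨(x, y), hp⟩ (YY hU k alA) * v k = Qa a x v y := by
  rw [Qa_apply, Finset.mul_sum]
  refine Finset.sum_congr rfl fun k _ => ?_
  rw [← mul_assoc, ← map_mul, h.rd.alY, yl, map_sum, Finset.sum_mul]
  refine Finset.sum_congr rfl fun j _ => ?_
  rw [map_mul, h.evA]
  change a x k j * y j * v k = _
  ring

theorem ev_al_sq (h : CS hU a b F aA aiA bA alA ali Fi) {x y : E n} (hp : (x, y) ∈ WW U) :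
    ev ⟨(x, y), hp⟩ alA * ev ⟨(x, y), hp⟩ alA = Qa a x y y := by
  rw [Qa_apply, ← map_mul, h.rd.alsq, map_sum]
  refine Finset.sum_congr rfl fun k _ => ?_
  rw [map_sum]
  refine Finset.sum_congr rfl fun j _ => ?_
  rw [map_mul, map_mul, h.evA]
  change a x k j * y k * y j = _
  ring

theorem Qa_symm (h : CS hU a b F aA aiA bA alA ali Fi) {x : E n} (hx : x ∈ U) (u v : E n) :
    Qa a x u v = Qa a x v u := by
  rw [Qa_apply, Qa_apply, Finset.sum_comm]
  refine Finset.sum_congr rfl fun k _ => Finset.sum_congr rfl fun j _ => ?_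
  have : a x j k = a x k j := by
    have := (h.apos x hx).isHermitian.apply k j
    simpa using this
  rw [this]; ring

theorem Qa_pos (h : CS hU a b F aA aiA bA alA ali Fi) {x : E n} (hx : x ∈ U) (v : E n) (hv : v ≠ 0) :
    0 < Qa a x v v := by
  have := (h.apos x hx).dotProduct_mulVec_pos hv
  refine lt_of_lt_of_eq this ?_
  rw [Qa_apply]
  simp only [dotProduct, Matrix.mulVec, Finset.mul_sum, Pi.star_apply, star_trivial]
  exact Finset.sum_congr rfl fun _ _ => Finset.sum_congr rfl fun _ _ => by ring

/-- the angular form. -/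
theorem hm_form (h : CS hU a b F aA aiA bA alA ali Fi) {x y : E n} (hp : (x, y) ∈ WW U) (v : E n) :
    (ev ⟨(x, y), hp⟩ alA) ^ 3 * ∑ j, ∑ k, hm n F j k x y * v j * v k
      = F x y * (Qa a x y y * Qa a x v v - (Qa a x v y) ^ 2) := by
  rw [← h.ev_al_Y hp v, ← h.ev_al_sq hp]
  set α := ev ⟨(x, y), hp⟩ alA with hα
  have e1 : α * ∑ j, ∑ k, hm n F j k x y * v j * v k
      = F x y * (Qa a x v v - (∑ k, ev ⟨(x, y), hp⟩ (YY hU k alA) * v k) ^ 2) := by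
    rw [sq, Finset.sum_mul_sum, Qa_apply, Finset.mul_sum, ← Finset.sum_sub_distrib, Finset.mul_sum]
    refine Finset.sum_congr rfl fun j _ => ?_
    rw [Finset.mul_sum, ← Finset.sum_sub_distrib, Finset.mul_sum]
    refine Finset.sum_congr rfl fun k _ => ?_
    have e2 := congrArg (ev ⟨(x, y), hp⟩) (h.rd.alYY j k)
    rw [map_mul, map_sub, map_mul, h.evA, ← hα, ← h.evA x y hp, h.rd.asymm, h.evA] at e2
    rw [h.rephm j k x y hp, map_mul, ← h.repF x y hp]
    linear_combination F x y * v j * v k * e2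
  linear_combination α ^ 2 * e1

theorem hm_pos (h : CS hU a b F aA aiA bA alA ali Fi) {x y : E n} (hp : (x, y) ∈ WW U) (v : E n)
    (hl : LinearIndependent ℝ ![y, v]) : 0 < ∑ j, ∑ k, hm n F j k x y * v j * v k := by
  have e := h.hm_form hp v
  have hα : 0 < ev ⟨(x, y), hp⟩ alA := h.alpos _
  have hF := h.fin.pos x hp.1 y hp.2
  have hne : Qa a x y y • v - Qa a x v y • y ≠ 0 := by
    intro h0
    have := LinearIndependent.pair_iff.mp hl (- Qa a x v y) (Qa a x y y) (by rw [← h0]; module)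
    exact (h.Qa_pos hp.1 y hp.2).ne' this.2
  have h1 := h.Qa_pos hp.1 _ hne
  have hs := h.Qa_symm hp.1 y v
  have h2 : Qa a x (Qa a x y y • v - Qa a x v y • y) (Qa a x y y • v - Qa a x v y • y)
      = Qa a x y y * (Qa a x y y * Qa a x v v - (Qa a x v y) ^ 2) := by
    simp only [map_sub, map_smul, LinearMap.sub_apply, LinearMap.smul_apply, smul_eq_mul, hs]
    ring
  rw [h2] at h1
  have h3 := (mul_pos_iff_of_pos_left (h.Qa_pos hp.1 y hp.2)).mp h1
  have h4 := mul_pos hF h3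
  rw [← e] at h4
  exact (mul_pos_iff_of_pos_left (pow_pos hα 3)).mp h4

set_option maxHeartbeats 1600000 in
/-- flag curvature of an orthonormal pair. -/
theorem flag_on (h : CS hU a b F aA aiA bA alA ali Fi) {x y : E n} (hp : (x, y) ∈ WW U) (p : E n)
    (hy : Qa a x y y = 1) (hpp : Qa a x p p = 1) (hyp : Qa a x y p = 0) :
    (F x y) ^ 2 * K n F x y p = Qb (fun m k => ev ⟨(x, y), hp⟩ (∑ i, aA m i *
      Ru (XX hU) (YY hU) (yc U) (GR (XX hU) (YY hU) (yc U) aiA bA alA Fi) i k)) p p := by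
  have hα : ev ⟨(x, y), hp⟩ alA = 1 := by
    have h1 := h.ev_al_sq hp
    have h2 := h.alpos ⟨(x, y), hp⟩
    rw [hy] at h1
    nlinarith
  have hpy : Qa a x p y = 0 := by rw [h.Qa_symm hp.1, hyp]
  have hh := h.hm_form hp p
  have hY := h.ev_al_Y hp p
  rw [hα, hpy, hy, hpp] at hh
  rw [hα, hpy, one_mul] at hY
  have hF := (h.fin.pos x hp.1 y hp.2).ne'
  have hden : ∑ j, ∑ k, hm n F j k x y * p j * p k = F x y := by linarith
  have hnum : ∑ j, ∑ k, Rlow n F j k x y * p j * p k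
      = F x y * Qb (fun m k => ev ⟨(x, y), hp⟩ (∑ i, aA m i *
      Ru (XX hU) (YY hU) (yc U) (GR (XX hU) (YY hU) (yc U) aiA bA alA Fi) i k)) p p := by
    set S : Fin n → ℝ := fun k => ev ⟨(x, y), hp⟩ (∑ i, YY hU i alA *
      Ru (XX hU) (YY hU) (yc U) (GR (XX hU) (YY hU) (yc U) aiA bA alA Fi) i k) with hS
    have e1 : ∀ j k, Rlow n F j k x y * p j * p k
       = F x y * (p j * ev ⟨(x, y), hp⟩ (∑ i, aA j i *
      Ru (XX hU) (YY hU) (yc U) (GR (XX hU) (YY hU) (yc U) aiA bA alA Fi) i k) * p k)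
        - (ev ⟨(x, y), hp⟩ (YY hU j alA) * p j) * (F x y * S k * p k) := by
      intro j k
      have e2 := congrArg (ev ⟨(x, y), hp⟩) (h.rd.al_Rlow j k)
      rw [map_mul, hα, one_mul, ← h.repRlow j k x y hp, map_mul, map_sub, map_mul (ev _) (YY hU j alA),
        ← h.repF x y hp] at e2
      linear_combination p j * p k * e2
    simp only [e1, Finset.sum_sub_distrib]
    rw [← Finset.sum_mul_sum, hY, zero_mul, sub_zero, Qb_apply, Finset.mul_sum]
    exact Finset.sum_congr rfl fun _ _ => by rw [Finset.mul_sum]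
  rw [K, hnum, hden]
  field_simp

end CS
end Pt

section Contract
variable {n : ℕ}

theorem Qb_add (f g : Fin n → Fin n → ℝ) (u w : E n) :
    Qb (fun i j => f i j + g i j) u w = Qb f u w + Qb g u w := by
  have := Qb_lin f g 1 1 u w
  simpa using this

theorem Qb_rank (f g : Fin n → ℝ) (u w : E n) :
    Qb (fun i j => f i * g j) u w = (∑ i, f i * u i) * ∑ j, g j * w j := by
  rw [Qb_apply, Finset.sum_mul_sum]
  exact Finset.sum_congr rfl fun _ _ => Finset.sum_congr rfl fun _ _ => by ring

theorem Qb_t (t : Fin n → Fin n → Fin n → Fin n → ℝ) (y p : E n) :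
    Qb (fun m k => ∑ l, ∑ q, y l * y q * t m q k l) p p
      = Qb (fun m q => Qb (t m q) p y) p y := by
  simp only [Qb_apply, Finset.mul_sum, Finset.sum_mul]
  refine Finset.sum_congr rfl fun m _ => ?_
  have e1 : ∀ k, ∑ l, ∑ q, p m * (y l * y q * t m q k l) * p k
      = ∑ q, ∑ l, p m * (y l * y q * t m q k l) * p k := fun k => Finset.sum_comm
  simp only [e1]
  rw [Finset.sum_comm]
  exact Finset.sum_congr rfl fun _ _ => Finset.sum_congr rfl fun _ _ =>
    Finset.sum_congr rfl fun _ _ => by ring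

theorem Qb_contract (f g : Fin n → Fin n → ℝ) (t : Fin n → Fin n → Fin n → Fin n → ℝ)
    (c s : Fin n → Fin n → ℝ) (w Z τ : Fin n → ℝ) (Ξ : ℝ) (y p : E n)
    (hf : ∀ m k, f m k = 2 * (∑ l, ∑ q, y l * y q * t m q k l)
      + 2 * (3 / 4 * (∑ j, c j k * y j) * (∑ j, c j m * y j) - 1 / 4 * (∑ j, c j m * s j k))
      + w k * Z m + g m k * Ξ + τ k * ∑ j, g m j * y j)
    (h1 : ∑ k, w k * p k = 0) (h2 : Qb g p y = 0) (h3 : Qb g p p = 1) :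
    Qb f p p = 2 * (om t c y p + Qb (fun m k => - (1 / 4) * ∑ j, c j m * s j k) p p + Ξ / 2) := by
  have e : f = fun m k => 2 * (∑ l, ∑ q, y l * y q * t m q k l) +
      (3 / 2 * ((∑ j, c j m * y j) * (∑ j, c j k * y j)) +
      (2 * (- (1 / 4) * ∑ j, c j m * s j k) + (Z m * w k + (Ξ * g m k + (∑ j, g m j * y j) * τ k)))) := by
    funext m k; rw [hf]; ring
  have h4 : ∑ m, (∑ j, g m j * y j) * p m = 0 := by
    rw [← h2, Qb_apply]
    refine Finset.sum_congr rfl fun m _ => ?_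
    rw [Finset.sum_mul]
    exact Finset.sum_congr rfl fun _ _ => by ring
  have h5 : ∑ m, (∑ j, c j m * y j) * p m = Qb c y p := by
    rw [Qb_apply, Finset.sum_comm]
    refine Finset.sum_congr rfl fun m _ => ?_
    rw [Finset.sum_mul]
    exact Finset.sum_congr rfl fun _ _ => by ring
  rw [e, Qb_add, Qb_add, Qb_add, Qb_add, Qb_add, Qb_smulf, Qb_smulf, Qb_smulf,
    Qb_smulf g,    Qb_rank, Qb_rank, Qb_rank, h1, h3, h4, h5, Qb_t, om]
  ring

end Contract

section Iso
variable {n : ℕ}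

theorem sec_hK {U : Set (E n)} {F : E n → E n → ℝ} (hsec : SectionalFlagCurv n U F) {x : E n}
    (hx : x ∈ U) (y v : E n) (p q r s : ℝ) (hl : LinearIndependent ℝ ![y, v])
    (hd : p * s - q * r ≠ 0) : K n F x (p • y + q • v) (r • y + s • v) = K n F x y v := by
  have hl' : LinearIndependent ℝ ![p • y + q • v, r • y + s • v] := by
    rw [LinearIndependent.pair_iff] at hl ⊢
    intro c d h0
    obtain ⟨h1, h2⟩ := hl (c * p + d * r) (c * q + d * s) (by rw [← h0]; module)
    constructor
    · apply (mul_eq_zero_iff_right hd).mp; linear_combination s * h1 - r * h2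
    · apply (mul_eq_zero_iff_right hd).mp; linear_combination p * h2 - q * h1
  refine hsec x hx _ _ _ _ hl' hl ?_
  apply le_antisymm
  · rw [Submodule.span_le]
    rintro z (rfl | rfl)
    · exact Submodule.mem_span_pair.mpr ⟨p, q, rfl⟩
    · exact Submodule.mem_span_pair.mpr ⟨r, s, rfl⟩
  · rw [Submodule.span_le]
    have key : ∀ z : E n, ∀ c d : ℝ, (p * s - q * r) • z = c • (p • y + q • v) + d • (r • y + s • v) →
        z ∈ Submodule.span ℝ {p • y + q • v, r • y + s • v} := by
      intro z c d hz
      rw [Submodule.mem_span_pair]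
      refine ⟨(p * s - q * r)⁻¹ * c, (p * s - q * r)⁻¹ * d, ?_⟩
      rw [mul_smul, mul_smul, ← smul_add, ← hz, inv_smul_smul₀ hd]
    rintro z (rfl | rfl)
    · exact key _ s (-q) (by module)
    · exact key _ (-r) p (by module)

namespace CS
variable {U : Set (E n)} {hU : IsOpen U} {a : E n → Matrix (Fin n) (Fin n) ℝ} {b : E n → E n}
    {F : E n → E n → ℝ} {aA aiA : Fin n → Fin n → Sm (WW U)} {bA : Fin n → Sm (WW U)}
    {alA ali Fi : Sm (WW U)}

set_option maxHeartbeats 3200000 in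
/-- the sum over both orientations. -/
theorem two_sided (h : CS hU a b F aA aiA bA alA ali Fi) : ∃ (Z τ : Fin n → Sm (WW U)) (Ξ : Sm (WW U)),
    ∀ x y (hp : (x, y) ∈ WW U) m k,
      ev ⟨(x, y), hp⟩ (∑ i, aA m i *
      Ru (XX hU) (YY hU) (yc U) (GR (XX hU) (YY hU) (yc U) aiA bA alA Fi) i k) +
      ev ⟨(x, -y), WW_neg hp⟩ (∑ i, aA m i *
      Ru (XX hU) (YY hU) (yc U) (GR (XX hU) (YY hU) (yc U) aiA bA alA Fi) i k)
      = 2 * (∑ l, ∑ q, y l * y q *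
          ev ⟨(x, y), hp⟩ (RData.c4 (XX hU) (YY hU) (yc U) aA aiA alA m q k l))
      + 2 * (3 / 4 * (∑ j, ev ⟨(x, y), hp⟩ (cc (XX hU) bA j k) * y j)
          * (∑ j, ev ⟨(x, y), hp⟩ (cc (XX hU) bA j m) * y j)
        - 1 / 4 * (ev ⟨(x, y), hp⟩ alA * ev ⟨(x, y), hp⟩ alA) *
          (∑ j, ev ⟨(x, y), hp⟩ (cc (XX hU) bA j m) * ev ⟨(x, y), hp⟩ (ss (XX hU) aiA bA j k)))
      + ev ⟨(x, y), hp⟩ (YY hU k alA) * ev ⟨(x, y), hp⟩ (Z m) + a x m k * ev ⟨(x, y), hp⟩ Ξ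
      + ev ⟨(x, y), hp⟩ (τ k) * ∑ j, a x m j * y j := by
  obtain ⟨Z, τ, Ξ, hc⟩ := h.rd.combined (sg U) (sg_X hU) (sg_Y hU) (sg_y U) h.sgai h.sgb h.sgal
  refine ⟨Z, τ, Ξ, fun x y hp m k => ?_⟩
  have e1 := congrArg (ev ⟨(x, y), hp⟩) (hc m k)
  rw [h.rd.a_Ru] at e1
  have ey : ∀ j, ev ⟨(x, y), hp⟩ (yc U j) = y j := fun j => rfl
  have el : ev ⟨(x, y), hp⟩ (∑ i, aA m i * (
      Ru (XX hU) (YY hU) (yc U) (GR (XX hU) (YY hU) (yc U) aiA bA alA Fi) i k +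
      sg U (Ru (XX hU) (YY hU) (yc U) (GR (XX hU) (YY hU) (yc U) aiA bA alA Fi) i k))) =
      ev ⟨(x, y), hp⟩ (∑ i, aA m i *
      Ru (XX hU) (YY hU) (yc U) (GR (XX hU) (YY hU) (yc U) aiA bA alA Fi) i k) +
      ev ⟨(x, -y), WW_neg hp⟩ (∑ i, aA m i *
      Ru (XX hU) (YY hU) (yc U) (GR (XX hU) (YY hU) (yc U) aiA bA alA Fi) i k) := by
    rw [map_sum, map_sum, map_sum, ← Finset.sum_add_distrib]
    refine Finset.sum_congr rfl fun i _ => ?_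
    rw [map_mul, map_mul, map_mul, map_add, ev_sg, h.evA, h.evA, mul_add]
  rw [← el, e1]
  simp only [yl, map_add, map_sub, map_mul (ev _), map_sum (ev _), map_ofNat, ey, h.evA, ev_hf]
  ring

set_option maxHeartbeats 1600000 in
/-- pointwise isotropy. -/
theorem iso (h : CS hU a b F aA aiA bA alA ali Fi) (hn : 3 ≤ n) (hb_ne : ∀ x ∈ U, b x ≠ 0)
    (hsec : SectionalFlagCurv n U F) {x : E n} (hx : x ∈ U) :
    ∃ c : ℝ, ∀ y v : E n, LinearIndependent ℝ ![y, v] → K n F x y v = c := by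
  obtain ⟨Z, τ, Ξ, h2⟩ := h.two_sided
  have hn0 : 0 < n := by omega
  obtain ⟨y0, hy0⟩ : ∃ y0 : E n, y0 ≠ 0 :=
    ⟨fun _ => 1, fun h0 => one_ne_zero (congrFun h0 ⟨0, hn0⟩)⟩
  have hp0 : (x, y0) ∈ WW U := ⟨hx, hy0⟩
  obtain ⟨t, ht⟩ : ∃ t : Fin n → Fin n → Fin n → Fin n → ℝ, t = fun m q k l =>
    ev ⟨(x, y0), hp0⟩ (RData.c4 (XX hU) (YY hU) (yc U) aA aiA alA m q k l) := ⟨_, rfl⟩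
  obtain ⟨c, hc⟩ : ∃ c : Fin n → Fin n → ℝ, c = fun j k =>
    ev ⟨(x, y0), hp0⟩ (cc (XX hU) bA j k) := ⟨_, rfl⟩
  obtain ⟨s, hs⟩ : ∃ s : Fin n → Fin n → ℝ, s = fun j k =>
    ev ⟨(x, y0), hp0⟩ (ss (XX hU) aiA bA j k) := ⟨_, rfl⟩
  have et : ∀ y (hp : (x, y) ∈ WW U) m q k l,
      ev ⟨(x, y), hp⟩ (RData.c4 (XX hU) (YY hU) (yc U) aA aiA alA m q k l) = t m q k l := by
    intro y hp m q k l
    rw [ht]; exact base_of_YY hU (by omega) (fun r => h.rd.Yc4 r m q k l) hp hp0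
  have ec : ∀ y (hp : (x, y) ∈ WW U) j k,
      ev ⟨(x, y), hp⟩ (cc (XX hU) bA j k) = c j k := by
    intro y hp j k
    rw [hc]; exact base_of_YY hU (by omega) (fun r => h.rd.Ycc r j k) hp hp0
  have es : ∀ y (hp : (x, y) ∈ WW U) j k,
      ev ⟨(x, y), hp⟩ (ss (XX hU) aiA bA j k) = s j k := by
    intro y hp j k
    rw [hs]; exact base_of_YY hU (by omega) (fun r => h.rd.Yss r j k) hp hp0
  have ht1 : ∀ m q k l, t m q k l = - t q m k l := by
    intro m q k l
    rw [← et y0 hp0 m, ← et y0 hp0 q, h.rd.c4_anti1, map_neg]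
  have ht2 : ∀ m q k l, t m q k l = - t m q l k := by
    intro m q k l
    rw [← et y0 hp0 m q k l, ← et y0 hp0 m q l k, RData.c4_anti2, map_neg]
  have hca : ∀ i j, c i j = - c j i := by
    intro i j
    rw [← ec y0 hp0 i j, ← ec y0 hp0 j i, RData.cc_anti, map_neg]
  let β : E n →ₗ[ℝ] ℝ := ∑ i, b x i • LinearMap.proj i
  have hβ : ∀ v, β v = ∑ i, b x i * v i := by intro v; simp [β]
  have P : PtData (Qa a x) β (K n F x) (om t c)
      (fun p => Qb (fun m k => - (1 / 4) * ∑ j, c j m * s j k) p p)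
      (fun y => ex Ξ.1 (x, y) / 2) :=
    { symm := fun u v => h.Qa_symm hx u v
      pos := fun v hv => h.Qa_pos hx v hv
      hK := fun y v p q r s hl hd => sec_hK hsec hx y v p q r s hl hd
      wsymm := om_symm t c ht1 ht2 hca
      wdet := fun y v p q r s => om_det t c ht1 ht2 hca y v p q r s
      wquad := om_quad t c
      squad := Qb_quad _
      hE := by
        intro y p hy hp hyp
        have hy0 : y ≠ 0 := by rintro rfl; simp at hy
        have hw : (x, y) ∈ WW U := ⟨hx, hy0⟩
        have hα : ev ⟨(x, y), hw⟩ alA = 1 := by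
          have h1 := h.ev_al_sq hw
          have h2 := h.alpos ⟨(x, y), hw⟩
          rw [hy] at h1
          nlinarith
        have hα' : ev ⟨(x, -y), WW_neg hw⟩ alA = 1 := by
          rw [← ev_sg hw, h.sgal, hα]
        have hF1 : F x y = 1 + β y := by
          rw [h.repF x y hw, map_add, hα, hβ, map_sum]
          congr 1
          refine Finset.sum_congr rfl fun i _ => ?_
          rw [map_mul, h.evB]; rfl
        have hF2 : F x (-y) = 1 - β y := by
          rw [h.repF x (-y) (WW_neg hw), map_add, hα', hβ, map_sum, sub_eq_add_neg,
            ← Finset.sum_neg_distrib]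
          congr 1
          refine Finset.sum_congr rfl fun i _ => ?_
          rw [map_mul, h.evB]
          exact mul_neg _ _
        have hli : LinearIndependent ℝ ![y, p] := by
          rw [LinearIndependent.pair_iff]
          intro r s h0
          have h3 : Qa a x y (r • y + s • p) = 0 := by rw [h0]; simp
          have h4 : Qa a x p (r • y + s • p) = 0 := by rw [h0]; simp
          rw [map_add, map_smul, map_smul, smul_eq_mul, smul_eq_mul] at h3 h4
          rw [h.Qa_symm hx p y] at h4
          rw [hy, hyp] at h3
          rw [hp, hyp] at h4
          constructor <;> linarith
        have hKn : K n F x (-y) p = K n F x y p := by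
          have := sec_hK hsec hx y p (-1) 0 0 1 hli (by norm_num)
          simpa using this
        have f1 := h.flag_on hw p hy hp hyp
        have f2 := h.flag_on (WW_neg hw) p (by simpa using hy) hp (by simpa using hyp)
        rw [hKn] at f2
        have hpy : Qa a x p y = 0 := by rw [h.Qa_symm hx, hyp]
        have hY := h.ev_al_Y hw p
        rw [hα, one_mul, hpy] at hY
        have key := Qb_contract _ (fun i j => a x i j) t c s
          (fun k => ev ⟨(x, y), hw⟩ (YY hU k alA)) (fun m => ev ⟨(x, y), hw⟩ (Z m))
          (fun k => ev ⟨(x, y), hw⟩ (τ k)) (ev ⟨(x, y), hw⟩ Ξ) y p (fun m k => by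
            have := h2 x y hw m k
            simp only [et, ec, es, hα, mul_one] at this
            exact this) hY hpy hp
        rw [Qb_add] at key
        rw [hF1] at f1
        rw [hF2] at f2
        have hx2 : ex Ξ.1 (x, y) = ev ⟨(x, y), hw⟩ Ξ := self_rep Ξ x y hw
        simp only [hx2]
        linear_combination (f1 + f2 + key) / 2 }
  refine P.isotropic (by simpa using hn) ?_
  intro h0
  apply hb_ne x hx
  funext i
  have := congrArg (fun f : E n →ₗ[ℝ] ℝ => f (Pi.single i 1)) h0
  simp only [hβ] at this
  simpa [Pi.single_apply] using this

end CS
end Iso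

section Fin9
variable {n : ℕ}

theorem Qb_single (f : Fin n → Fin n → ℝ) (i j : Fin n) :
    Qb f (Pi.single i 1) (Pi.single j 1) = f i j := by
  rw [Qb_apply]
  simp [Pi.single_apply]

theorem Qb_zero (f : Fin n → Fin n → ℝ) (hs : ∀ i j, f i j = f j i) (hq : ∀ v, Qb f v v = 0)
    (i j : Fin n) : f i j = 0 := by
  have h1 := hq (Pi.single i 1 + Pi.single j 1)
  simp only [map_add, LinearMap.add_apply, hq, Qb_single] at h1
  have := hs i j
  linarith

namespace CS
variable {U : Set (E n)} {hU : IsOpen U} {a : E n → Matrix (Fin n) (Fin n) ℝ} {b : E n → E n}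
    {F : E n → E n → ℝ} {aA aiA : Fin n → Fin n → Sm (WW U)} {bA : Fin n → Sm (WW U)}
    {alA ali Fi : Sm (WW U)}

theorem hm_symm (h : CS hU a b F aA aiA bA alA ali Fi) {x y : E n} (hp : (x, y) ∈ WW U)
    (j k : Fin n) : hm n F j k x y = hm n F k j x y := by
  rw [h.rephm j k x y hp, h.rephm k j x y hp, h.rd.fr.YY]

theorem Rlow_symm (h : CS hU a b F aA aiA bA alA ali Fi) {x y : E n} (hp : (x, y) ∈ WW U)
    (j k : Fin n) : Rlow n F j k x y = Rlow n F k j x y := by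
  rw [h.repRlow j k x y hp, h.repRlow k j x y hp]
  congr 1
  have e := Ru_symm h.rd.fr _ h.rd.EuGR _ h.rd.EuFsq h.rd.ELR k j
  simp only [mul_assoc]
  rw [← Finset.mul_sum, ← Finset.mul_sum]
  congr 1
  simp only [h.rd.fr.YY _ j, h.rd.fr.YY _ k]
  simp only [mul_comm _ (Ru _ _ _ _ _ _)]
  exact e

theorem Rlow_y (h : CS hU a b F aA aiA bA alA ali Fi) {x y : E n} (hp : (x, y) ∈ WW U)
    (j : Fin n) : ∑ k, Rlow n F j k x y * y k = 0 := by
  have e : ∀ i, ∑ k, RiemUp n F i k x y * y k = 0 := by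
    intro i
    have := congrArg (ev ⟨(x, y), hp⟩) (Ru_y h.rd.fr _ h.rd.EuGR i)
    rw [map_sum, map_zero] at this
    rw [← this]
    refine Finset.sum_congr rfl fun k _ => ?_
    rw [map_mul, ← h.repRiem i k x y hp]
    rfl
  simp only [Rlow, Finset.sum_mul]
  rw [Finset.sum_comm]
  simp only [mul_assoc, ← Finset.mul_sum, e, mul_zero, Finset.sum_const_zero]

theorem Rlow_iso (h : CS hU a b F aA aiA bA alA ali Fi) {x y : E n} (hp : (x, y) ∈ WW U) (c : ℝ)
    (hc : ∀ v : E n, LinearIndependent ℝ ![y, v] → K n F x y v = c) (j k : Fin n) :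
    Rlow n F j k x y = c * (F x y) ^ 2 * hm n F j k x y := by
  have hF := h.fin.pos x hp.1 y hp.2
  have := Qb_zero (fun j k => Rlow n F j k x y + (- (c * (F x y) ^ 2)) * hm n F j k x y) ?_ ?_ j k
  · linarith
  · intro i j
    rw [h.Rlow_symm hp, h.hm_symm hp]
  · intro v
    rw [Qb_add, Qb_smulf]
    have e1 : Qb (fun j k => Rlow n F j k x y) v v = ∑ j, ∑ k, Rlow n F j k x y * v j * v k := by
      rw [Qb_apply]
      exact Finset.sum_congr rfl fun _ _ => Finset.sum_congr rfl fun _ _ => by ring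
    have e2 : Qb (fun j k => hm n F j k x y) v v = ∑ j, ∑ k, hm n F j k x y * v j * v k := by
      rw [Qb_apply]
      exact Finset.sum_congr rfl fun _ _ => Finset.sum_congr rfl fun _ _ => by ring
    rw [e1, e2]
    by_cases hl : LinearIndependent ℝ ![y, v]
    · have h1 := hc v hl
      have h2 := h.hm_pos hp v hl
      have h3 : (F x y) ^ 2 * ∑ j, ∑ k, hm n F j k x y * v j * v k ≠ 0 := by positivity
      rw [K, div_eq_iff h3] at h1
      rw [h1]; ring
    · rw [LinearIndependent.pair_iff' hp.2] at hl
      push Not at hl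
      obtain ⟨r, hr⟩ := hl
      have hm0 := h.hm_form hp v
      have hα : 0 < ev ⟨(x, y), hp⟩ alA := h.alpos _
      have hz : Qa a x y y * Qa a x v v - (Qa a x v y) ^ 2 = 0 := by
        rw [← hr]; simp only [map_smul, LinearMap.smul_apply, smul_eq_mul]; ring
      rw [hz, mul_zero] at hm0
      have hm1 := (mul_eq_zero.mp hm0).resolve_left (pow_pos hα 3).ne'
      rw [hm1, mul_zero, add_zero]
      have e3 : ∀ j, ∑ k, Rlow n F j k x y * v j * v k = 0 := by
        intro j
        have := h.Rlow_y hp j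
        calc ∑ k, Rlow n F j k x y * v j * v k = v j * r * ∑ k, Rlow n F j k x y * y k := by
              rw [Finset.mul_sum]
              refine Finset.sum_congr rfl fun k _ => ?_
              have : v k = r * y k := by rw [← hr]; rfl
              rw [this]; ring
          _ = 0 := by rw [this, mul_zero]
      simp only [e3, Finset.sum_const_zero]

theorem g_alg (h : CS hU a b F aA aiA bA alA ali Fi) (j k : Fin n) :
    ∑ i, (hf2 _ * YY hU j (YY hU i
      ((alA + ∑ i, bA i * yc U i) * (alA + ∑ i, bA i * yc U i)))) *
      ((if i = k then 2 * ((alA + ∑ i, bA i * yc U i) * (alA + ∑ i, bA i * yc U i)) else 0)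
        - YY hU k ((alA + ∑ i, bA i * yc U i) * (alA + ∑ i, bA i * yc U i)) * yc U i)
    = 2 * ((alA + ∑ i, bA i * yc U i) * (alA + ∑ i, bA i * yc U i)) *
      ((alA + ∑ i, bA i * yc U i) * YY hU j (YY hU k alA)) := by
  have e0 := h.rd.h_eq j k
  have eE := Eu_Y h.rd.fr j ((alA + ∑ i, bA i * yc U i) * (alA + ∑ i, bA i * yc U i))
  rw [h.rd.EuFsq, Eu_apply] at eE
  have d1 : ∀ m, YY hU m ((alA + ∑ i, bA i * yc U i) * (alA + ∑ i, bA i * yc U i))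
    = 2 * ((alA + ∑ i, bA i * yc U i) * YY hU m (alA + ∑ i, bA i * yc U i)) := by
    intro m; rw [D_mul]; ring
  have d2 : YY hU j (2 * ((alA + ∑ i, bA i * yc U i) * (alA + ∑ i, bA i * yc U i)))
     = 2 * YY hU j ((alA + ∑ i, bA i * yc U i) * (alA + ∑ i, bA i * yc U i)) := by
    rw [two_mul, map_add, two_mul]
  rw [d2] at eE
  have dj := d1 j
  have dk := d1 k
  rw [← e0]
  generalize YY hU j (alA + ∑ i, bA i * yc U i) = Fj at *
  generalize YY hU k (alA + ∑ i, bA i * yc U i) = Fk at *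
  generalize (alA + ∑ i, bA i * yc U i) = FA at *
  simp only [mul_sub, Finset.sum_sub_distrib, mul_ite, mul_zero, Finset.sum_ite_eq',
    Finset.mem_univ, if_true]
  have e3 : ∑ i, hf2 (Sm (WW U)) * YY hU j (YY hU i (FA * FA)) * (YY hU k (FA * FA) * yc U i)
      = hf2 _ * YY hU k (FA * FA) * ∑ i, yc U i * YY hU i (YY hU j (FA * FA)) := by
    rw [Finset.mul_sum]
    refine Finset.sum_congr rfl fun i _ => ?_
    rw [h.rd.fr.YY j i]; ring
  rw [e3, eE, dj, dk]
  have h2 : 2 * hf2 (Sm (WW U)) = 1 := two_hf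
  linear_combination (- 2 * FA * FA * Fj * Fk) * h2

theorem Ru_iso (h : CS hU a b F aA aiA bA alA ali Fi) {x y : E n} (hp : (x, y) ∈ WW U) (c : ℝ)
    (hc : ∀ v : E n, LinearIndependent ℝ ![y, v] → K n F x y v = c) (i k : Fin n) :
    2 * ev ⟨(x, y), hp⟩ (Ru (XX hU) (YY hU) (yc U) (GR (XX hU) (YY hU) (yc U) aiA bA alA Fi) i k)
    = c * ev ⟨(x, y), hp⟩
      ((if i = k then 2 * ((alA + ∑ i, bA i * yc U i) * (alA + ∑ i, bA i * yc U i)) else 0)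
        - YY hU k ((alA + ∑ i, bA i * yc U i) * (alA + ∑ i, bA i * yc U i)) * yc U i) := by
  rw [← h.repRiem i k x y hp]
  have := h.g_inj hp (fun i => 2 * RiemUp n F i k x y - c * ev ⟨(x, y), hp⟩
      ((if i = k then 2 * ((alA + ∑ i, bA i * yc U i) * (alA + ∑ i, bA i * yc U i)) else 0)
        - YY hU k ((alA + ∑ i, bA i * yc U i) * (alA + ∑ i, bA i * yc U i)) * yc U i)) ?_
  · have := congrFun this i
    exact sub_eq_zero.mp this
  · intro l
    have e1 := h.Rlow_iso hp c hc l k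
    have e2 := congrArg (ev ⟨(x, y), hp⟩) (h.g_alg l k)
    rw [map_sum, map_mul (ev _) (2 * _), ← h.rephm l k x y hp, map_mul (ev _) 2,
      map_mul (ev _) (alA + ∑ i, bA i * yc U i), ← h.repF x y hp, map_ofNat] at e2
    simp only [map_mul (ev _) (hf2 _ * _), ← h.repgm l _ x y hp] at e2
    rw [Rlow] at e1
    simp only [h.gm_symm hp _ l] at e1
    have e3 : ∀ i, gm n F l i x y * (2 * RiemUp n F i k x y - c * ev ⟨(x, y), hp⟩
      ((if i = k then 2 * ((alA + ∑ i, bA i * yc U i) * (alA + ∑ i, bA i * yc U i)) else 0)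
        - YY hU k ((alA + ∑ i, bA i * yc U i) * (alA + ∑ i, bA i * yc U i)) * yc U i))
        = 2 * (gm n F l i x y * RiemUp n F i k x y) - c * (gm n F l i x y * ev ⟨(x, y), hp⟩
      ((if i = k then 2 * ((alA + ∑ i, bA i * yc U i) * (alA + ∑ i, bA i * yc U i)) else 0)
        - YY hU k ((alA + ∑ i, bA i * yc U i) * (alA + ∑ i, bA i * yc U i)) * yc U i)) := by
      intro i; ring
    simp only [e3]
    rw [Finset.sum_sub_distrib, ← Finset.mul_sum, ← Finset.mul_sum, e1, e2]
    ring

theorem trace_alg (h : CS hU a b F aA aiA bA alA ali Fi) :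
    ∑ i, ((if i = i then 2 * ((alA + ∑ i, bA i * yc U i) * (alA + ∑ i, bA i * yc U i)) else 0)
        - YY hU i ((alA + ∑ i, bA i * yc U i) * (alA + ∑ i, bA i * yc U i)) * yc U i)
    = (2 * (n : Sm (WW U)) - 2) * ((alA + ∑ i, bA i * yc U i) * (alA + ∑ i, bA i * yc U i)) := by
  have eE := h.rd.EuFsq
  rw [Eu_apply] at eE
  generalize (alA + ∑ i, bA i * yc U i) = FA at *
  rw [Finset.sum_sub_distrib]
  simp only [mul_comm _ (yc U _)]
  rw [eE]
  simp only [if_true, Finset.sum_const, Finset.card_univ, Fintype.card_fin, nsmul_eq_mul]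
  ring

/-- the curvature function as a smooth function. -/
theorem exists_c (h : CS hU a b F aA aiA bA alA ali Fi) (hn : 3 ≤ n)
    (hi : ∀ x ∈ U, ∃ c : ℝ, ∀ y v : E n, LinearIndependent ℝ ![y, v] → K n F x y v = c) :
    ∃ cA : Sm (WW U), ∀ x y (hp : (x, y) ∈ WW U) (y' v : E n), LinearIndependent ℝ ![y', v] →
      K n F x y' v = ev ⟨(x, y), hp⟩ cA := by
  refine ⟨algebraMap ℝ _ (1 / ((n : ℝ) - 1)) * (∑ i,
    Ru (XX hU) (YY hU) (yc U) (GR (XX hU) (YY hU) (yc U) aiA bA alA Fi) i i) * (Fi * Fi), ?_⟩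
  intro x y hp y' v hl
  obtain ⟨c, hc⟩ := hi x hp.1
  rw [hc y' v hl]
  have e1 := fun i => h.Ru_iso hp c (hc y) i i
  have e2 := congrArg (ev ⟨(x, y), hp⟩) h.trace_alg
  have e3 : 2 * ev ⟨(x, y), hp⟩ (∑ i, Ru (XX hU) (YY hU) (yc U)
      (GR (XX hU) (YY hU) (yc U) aiA bA alA Fi) i i) = c * ((2 * (n : ℝ) - 2) * (F x y * F x y)) := by
    have e4 : ev ⟨(x, y), hp⟩ ((2 * (n : Sm (WW U)) - 2) *
        ((alA + ∑ i, bA i * yc U i) * (alA + ∑ i, bA i * yc U i)))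
        = (2 * (n : ℝ) - 2) * (F x y * F x y) := by
      rw [map_mul, map_mul, ← h.repF x y hp, map_sub, map_mul, map_ofNat, map_natCast]
    rw [← e4, ← e2, map_sum, map_sum, Finset.mul_sum, Finset.mul_sum]
    exact Finset.sum_congr rfl fun i _ => e1 i
  have e5 := congrArg (ev ⟨(x, y), hp⟩) h.rd.hFi
  rw [map_mul, ← h.repF x y hp, map_one] at e5
  have hn1 : (n : ℝ) - 1 ≠ 0 := by
    have : (3 : ℝ) ≤ n := by exact_mod_cast hn
    linarith
  rw [map_mul, map_mul, map_mul, AlgHom.commutes]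
  change c = 1 / ((n : ℝ) - 1) * _ * _
  have e6 : ev ⟨(x, y), hp⟩ (∑ i, Ru (XX hU) (YY hU) (yc U)
      (GR (XX hU) (YY hU) (yc U) aiA bA alA Fi) i i) = c * (((n : ℝ) - 1) * (F x y * F x y)) := by
    linarith
  rw [e6]
  generalize ev ⟨(x, y), hp⟩ Fi = f at *
  have e7 : 1 / ((n : ℝ) - 1) * ((n : ℝ) - 1) = 1 := by field_simp
  linear_combination (- c * (F x y * f) ^ 2) * e7 - c * (1 + F x y * f) * e5

theorem X_zero (h : CS hU a b F aA aiA bA alA ali Fi) (hn : 3 ≤ n) (cA : Sm (WW U))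
    (hcA : ∀ x y (hp : (x, y) ∈ WW U) (y' v : E n), LinearIndependent ℝ ![y', v] →
      K n F x y' v = ev ⟨(x, y), hp⟩ cA) (m : Fin n) : XX hU m cA = 0 := by
  have hY : ∀ k, YY hU k cA = 0 := by
    apply YY_of_base
    intro x y y' hy hy'
    obtain ⟨v, hv⟩ : ∃ v : E n, LinearIndependent ℝ ![y, v] := by
      have : 1 < Module.finrank ℝ (E n) := by simp; omega
      exact exists_linearIndependent_pair_of_one_lt_finrank this hy.2
    rw [← hcA x y hy y v hv, ← hcA x y' hy' y v hv]
  have hR : ∀ i k, 2 * Ru (XX hU) (YY hU) (yc U) (GR (XX hU) (YY hU) (yc U) aiA bA alA Fi) i k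
    = cA * ((if i = k then 2 * ((alA + ∑ i, bA i * yc U i) * (alA + ∑ i, bA i * yc U i)) else 0)
        - YY hU k ((alA + ∑ i, bA i * yc U i) * (alA + ∑ i, bA i * yc U i)) * yc U i) := by
    intro i k
    apply Sm_ext
    rintro ⟨⟨x, y⟩, hp⟩
    have := h.Ru_iso hp (ev ⟨(x, y), hp⟩ cA) (fun v hv => hcA x y hp y v hv) i k
    rw [map_mul, map_mul (ev _) cA, map_ofNat]
    exact this
  obtain ⟨l, hlm⟩ : ∃ l : Fin n, l ≠ m := by
    have : Nontrivial (Fin n) := Fin.nontrivial_iff_two_le.mpr (by omega)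
    exact exists_ne m
  obtain ⟨k, hkl, hkm⟩ : ∃ k : Fin n, k ≠ l ∧ k ≠ m := by
    obtain ⟨k, hk⟩ := Finset.exists_mem_notMem_of_card_lt_card (s := {l, m}) (t := Finset.univ) (by
      rw [Finset.card_pair hlm, Finset.card_univ, Fintype.card_fin]; omega)
    simp at hk
    exact ⟨k, hk⟩
  have hs := schur h.rd.fr _ h.rd.EuGR _ cA h.rd.EuFsq h.rd.ELR hY hR k l m hkl hkm hlm
  have hYX : ∀ j m, YY hU j (XX hU m cA) = 0 := by
    intro j m; rw [h.rd.fr.XY, hY, map_zero]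
  apply Sm_ext
  rintro ⟨⟨x, y⟩, hp⟩
  have key := h.g_inj hp (fun i => (if i = l then ev ⟨(x, y), hp⟩ (XX hU m cA) else 0)
    - (if i = m then ev ⟨(x, y), hp⟩ (XX hU l cA) else 0)) (by
      intro j
      have e1 := congrArg (YY hU j) hs
      rw [D_mul _ (XX hU m cA), D_mul _ (XX hU l cA), hYX, hYX, zero_mul, zero_mul, add_zero, add_zero] at e1
      have e2 := congrArg (fun z => ev ⟨(x, y), hp⟩ (hf2 _ * z)) e1
      simp only [mul_left_comm (hf2 _)] at e2
      rw [map_mul, map_mul (ev _) (XX hU l cA), ← h.repgm j l x y hp, ← h.repgm j m x y hp] at e2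
      simp only [mul_sub, mul_ite, mul_zero, Finset.sum_sub_distrib, Finset.sum_ite_eq',
        Finset.mem_univ, if_true]
      linarith)
  have := congrFun key l
  simpa [hlm] using this

theorem const (h : CS hU a b F aA aiA bA alA ali Fi) (hn : 3 ≤ n) (hconn : IsConnected U)
    (hi : ∀ x ∈ U, ∃ c : ℝ, ∀ y v : E n, LinearIndependent ℝ ![y, v] → K n F x y v = c) :
    ∃ c : ℝ, ∀ x ∈ U, ∀ y v : E n, LinearIndependent ℝ ![y, v] → K n F x y v = c := by
  obtain ⟨cA, hcA⟩ := h.exists_c hn hi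
  have hX := h.X_zero hn cA hcA
  have hn0 : 0 < n := by omega
  obtain ⟨y0, hy0⟩ : ∃ y0 : E n, y0 ≠ 0 :=
    ⟨fun _ => 1, fun h0 => one_ne_zero (congrFun h0 ⟨0, hn0⟩)⟩
  have hd : DifferentiableOn ℝ (fun x => ex cA.1 (x, y0)) U := by
    intro z hz
    have := (Sm_diff (WW_open hU) cA (p := (z, y0)) ⟨hz, hy0⟩)
    exact (DifferentiableAt.comp (f := fun x => (x, y0)) z this (by fun_prop)).differentiableWithinAt
  have h0 : U.EqOn (fderiv ℝ (fun x => ex cA.1 (x, y0))) 0 := by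
    intro z hz
    have hz' : (z, y0) ∈ WW U := ⟨hz, hy0⟩
    have : ∀ k, fderiv ℝ (fun x => ex cA.1 (x, y0)) z (e n k) = 0 := by
      intro k
      have := (self_rep cA).pdx hU k z y0 hz'
      rw [hX k, map_zero] at this
      exact this
    ext v
    have hv : v = ∑ k, v k • e n k := by
      ext j; simp [e, Finset.sum_apply, Pi.single_apply]
    rw [hv, map_sum]
    simp [this]
  obtain ⟨c, hc⟩ := hU.exists_is_const_of_fderiv_eq_zero hconn.isPreconnected hd h0
  refine ⟨c, fun x hx y v hl => ?_⟩
  rw [← hc x hx, hcA x y0 ⟨hx, hy0⟩ y v hl]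
  exact (self_rep cA x y0 ⟨hx, hy0⟩).symm

end CS
end Fin9

/-- A Randers metric `F = α + β` with nowhere vanishing `β` on a connected
open set `U ⊆ ℝⁿ` (n ≥ 3) which is of sectional flag curvature has constant flag
curvature. -/
theorem randers_sectional_flag_curvature_constant (n : ℕ) (hn : 3 ≤ n)
    (U : Set (E n)) (hU : IsOpen U) (hconn : IsConnected U)
    (a : E n → Matrix (Fin n) (Fin n) ℝ) (b : E n → E n)
    (ha_smooth : ∀ i j : Fin n, ContDiffOn ℝ (⊤ : ℕ∞) (fun x => a x i j) U)
    (hb_smooth : ∀ i : Fin n, ContDiffOn ℝ (⊤ : ℕ∞) (fun x => b x i) U)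
    (ha_symm : ∀ x ∈ U, (a x).IsSymm)
    (ha_posdef : ∀ x ∈ U, (a x).PosDef)
    (hb_small : ∀ x ∈ U, ∑ i, ∑ j, (a x)⁻¹ i j * b x i * b x j < 1)
    (hb_ne : ∀ x ∈ U, b x ≠ 0)
    (F : E n → E n → ℝ)
    (hF_eq : ∀ x ∈ U, ∀ y : E n,
      F x y = Real.sqrt (∑ i, ∑ j, a x i j * y i * y j) + ∑ i, b x i * y i)
    (hF : IsFinsler n U F) (hsec : SectionalFlagCurv n U F) :
    ∃ c : ℝ, ∀ x ∈ U, ∀ y v : E n, LinearIndependent ℝ ![y, v] →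
      K n F x y v = c := by
  obtain ⟨aA, aiA, bA, alA, ali, Fi, h⟩ :=
    exists_CS U hU a b ha_smooth hb_smooth ha_symm ha_posdef F hF_eq hF
  exact h.const hn hconn fun x hx => h.iso hn hb_ne hsec hx

end Paper
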